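/- arXiv:1506.06286 — 3 statements merged into one kernel-verified Lean document; each statement's English description precedes it below -/
import Mathlib

section
/- Let q be a prime power, A = F_q[θ], and n an integer with 0 ≤ n ≤ q−1. Let 𝔸 = F_q(t₁,…,t_n)[θ], φ the canonical deformation of the Carlitz module given by φ_θ = (t₁−θ)⋯(t_n−θ)τ + θ, with exponential exp_φ = Σ_{j≥0} b_j(t₁)⋯b_j(t_n)τ^j/D_j where b_j(t) = ∏_{k=0}^{j−1}(t − θ^{q^k}). Let 𝓛 = Σ_{a monic in A} a(t₁)⋯a(t_n)/a, the L-series, which converges in the Tate algebra. Then exp_φ(𝓛) = 1. -/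
open Polynomial

section TateAlgebra

variable (Fq : Type*) [Field Fq] (n : ℕ)

/- The Tate algebra `T_n(K_∞)` is realized as the ring of Laurent series in
`u = 1/θ` with coefficients in `F_q[t₁,…,t_n]`, i.e.
`LaurentSeries (MvPolynomial (Fin n) Fq)`; an element of `T_n(K_∞)` is exactly
a series `Σ_{i ≥ i₀} c_i u^i` with `c_i ∈ F_q[t₁,…,t_n]`. -/

/-- `θ = u⁻¹` inside the Tate algebra. -/
noncomputable def thetaTate : LaurentSeries (MvPolynomial (Fin n) Fq) :=
  HahnSeries.single (-1 : ℤ) 1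

/-- The embedding of `A = F_q[θ]` into the Tate algebra, `a ↦ a(θ)`. -/
noncomputable def polyToTate (a : Polynomial Fq) :
    LaurentSeries (MvPolynomial (Fin n) Fq) :=
  Polynomial.aeval (thetaTate Fq n) a

/-- `b_j(t₁)⋯b_j(t_n)` where `b_j(t) = ∏_{k<j} (t − θ^{q^k})`. -/
noncomputable def tateBProd (q j : ℕ) : LaurentSeries (MvPolynomial (Fin n) Fq) :=
  ∏ i : Fin n, ∏ k ∈ Finset.range j,
    (HahnSeries.C (MvPolynomial.X i) - (thetaTate Fq n) ^ q ^ k)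

/-- `a(t₁)⋯a(t_n)`, for `a ∈ A`. -/
noncomputable def tateAProd (a : Polynomial Fq) :
    LaurentSeries (MvPolynomial (Fin n) Fq) :=
  ∏ i : Fin n, HahnSeries.C (Polynomial.aeval (MvPolynomial.X i) a)

end TateAlgebra

section Helpers

variable {F : Type*} [Field F] [Fintype F] {L : Type*} [Field L] [Algebra F L]

theorem hlp_aeval_pow {R : Type*} [CommRing R] [Algebra F R] (x : R) (a : F[X]) (j : ℕ) :
    Polynomial.aeval (x ^ (Fintype.card F) ^ j) a
      = (Polynomial.aeval x a) ^ (Fintype.card F) ^ j := by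
  have h := Polynomial.aeval_algHom_apply ((FiniteField.frobeniusAlgHom F R) ^ j) x a
  simpa [AlgHom.coe_pow, FiniteField.coe_frobeniusAlgHom, pow_iterate] using h

theorem hlp_sub_pow {R : Type*} [CommRing R] [Algebra F R] (x y : R) :
    (x - y) ^ (Fintype.card F) = x ^ (Fintype.card F) - y ^ (Fintype.card F) := by
  exact map_sub (FiniteField.frobeniusAlgHom F R) x y

theorem hlp_inj (x : L) (hx : Function.Injective (fun a : F[X] => Polynomial.aeval x a)) :
    Function.Injective (fun i : ℕ => x ^ (Fintype.card F) ^ i) := by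
  intro i j h
  have h1 : Polynomial.aeval x (X ^ (Fintype.card F) ^ i : F[X])
      = Polynomial.aeval x (X ^ (Fintype.card F) ^ j : F[X]) := by simpa using h
  have h3 : (X ^ (Fintype.card F) ^ i : F[X]) = X ^ (Fintype.card F) ^ j := hx h1
  have h2 := congrArg Polynomial.natDegree h3
  simp only [natDegree_X_pow] at h2
  exact Nat.pow_right_injective (Fintype.one_lt_card (α := F)) h2

open Classical in
/-- monic polynomials of degree `d` -/
noncomputable def hlpMon (F : Type*) [Field F] [Fintype F] (d : ℕ) : Finset F[X] :=
  (Finset.univ : Finset (Fin d → F)).image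
    fun c => (((monicEquivDegreeLT d).trans (degreeLTEquiv F d).toEquiv).symm c).1

theorem hlpMon_mem (d : ℕ) (a : F[X]) : a ∈ hlpMon F d ↔ a.Monic ∧ a.natDegree = d := by
  unfold hlpMon
  simp only [Finset.mem_image, Finset.mem_univ, true_and]
  constructor
  · rintro ⟨c, rfl⟩
    exact (((monicEquivDegreeLT d).trans (degreeLTEquiv F d).toEquiv).symm c).2
  · intro h
    exact ⟨((monicEquivDegreeLT d).trans (degreeLTEquiv F d).toEquiv) ⟨a, h⟩, by simp⟩

theorem hlpMon_card (d : ℕ) : (hlpMon F d).card = (Fintype.card F) ^ d := by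
  classical
  unfold hlpMon
  rw [Finset.card_image_of_injective]
  · simp
  · exact Subtype.val_injective.comp (Equiv.injective _)

theorem hlp_interp (x : L) (hx : Function.Injective (fun a : F[X] => Polynomial.aeval x a)) (d : ℕ)
    (a : F[X]) (ha : a ∈ hlpMon F d) (t : L) :
    Polynomial.aeval t a = ∏ k ∈ Finset.range d, (t - x ^ (Fintype.card F) ^ k)
      + ∑ i ∈ Finset.range d,
        (Lagrange.basis (Finset.range d) (fun i : ℕ => x ^ (Fintype.card F) ^ i) i).eval t
          * (Polynomial.aeval x a) ^ (Fintype.card F) ^ i := by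
  classical
  rw [hlpMon_mem] at ha
  obtain ⟨ham, had⟩ := ha
  set y : ℕ → L := fun i => x ^ (Fintype.card F) ^ i with hy
  have hinj : Set.InjOn y (Finset.range d) := (hlp_inj x hx).injOn
  have hm : (a.map (algebraMap F L)).Monic := ham.map _
  have hdeg : (a.map (algebraMap F L)).degree = d := by
    rw [Polynomial.degree_map, Polynomial.degree_eq_natDegree ham.ne_zero, had]
  have hlt : (a.map (algebraMap F L) - Lagrange.nodal (Finset.range d) y).degree
      < (Finset.range d).card := by
    have := Polynomial.degree_sub_lt_left (p := a.map (algebraMap F L))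
      (q := Lagrange.nodal (Finset.range d) y) (by rw [hdeg, Lagrange.degree_nodal]; simp)
      hm.ne_zero (by rw [hm.leadingCoeff, Lagrange.nodal_monic.leadingCoeff])
    rw [hdeg] at this
    simpa using this
  have h := Lagrange.eq_interpolate_of_eval_eq (r := fun i => (Polynomial.aeval x a) ^ (Fintype.card F) ^ i)
    hinj hlt (by
      intro i hi
      rw [eval_sub, Lagrange.eval_nodal_at_node hi, sub_zero, Polynomial.eval_map_algebraMap]
      exact hlp_aeval_pow x a i)
  have h2 := congrArg (Polynomial.eval t) h
  rw [eval_sub, Polynomial.eval_map_algebraMap, Lagrange.eval_nodal, sub_eq_iff_eq_add'] at h2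
  rw [h2, Lagrange.interpolate_apply, eval_finsetSum]
  congr 1
  refine Finset.sum_congr rfl fun i _ => ?_
  rw [eval_mul, eval_C, mul_comm]

/-- interpolating polynomial -/
noncomputable def hlpP (F : Type*) [Field F] [Fintype F] {L : Type*} [Field L]
    (x : L) (d : ℕ) (t : L) : L[X] :=
  C (∏ k ∈ Finset.range d, (t - x ^ (Fintype.card F) ^ k))
      + ∑ i ∈ Finset.range d,
        C ((Lagrange.basis (Finset.range d) (fun i : ℕ => x ^ (Fintype.card F) ^ i) i).eval t)
          * X ^ (Fintype.card F) ^ i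

theorem hlpP_eval (x : L) (hx : Function.Injective (fun a : F[X] => Polynomial.aeval x a)) (d : ℕ)
    (a : F[X]) (ha : a ∈ hlpMon F d) (t : L) :
    (hlpP F x d t).eval (Polynomial.aeval x a) = Polynomial.aeval t a := by
  rw [hlp_interp x hx d a ha t, hlpP]
  simp only [eval_add, eval_C, eval_finsetSum, eval_mul, eval_pow, eval_X]

theorem hlpP_eval_zero (x : L) (d : ℕ) (t : L) :
    (hlpP F x d t).eval 0 = ∏ k ∈ Finset.range d, (t - x ^ (Fintype.card F) ^ k) := by
  have hc : Fintype.card F ≠ 0 := Fintype.card_ne_zero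
  rw [hlpP]
  simp [-map_prod, -map_sub, -map_pow, eval_finsetSum, hc]

theorem hlpP_natDegree (x : L) (d : ℕ) (t : L) :
    (hlpP F x (d + 1) t).natDegree ≤ (Fintype.card F) ^ d := by
  rw [hlpP]
  refine (natDegree_add_le _ _).trans (max_le (by rw [natDegree_C]; exact Nat.zero_le _) ?_)
  refine natDegree_sum_le_of_forall_le _ _ fun i hi => ?_
  refine (natDegree_C_mul_X_pow_le _ _).trans ?_
  exact Nat.pow_le_pow_right Fintype.card_pos (by simpa [Nat.lt_succ_iff] using hi)

theorem hlp_nodal (x : L) (hx : Function.Injective (fun a : F[X] => Polynomial.aeval x a)) (d : ℕ) :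
    Lagrange.nodal (hlpMon F (d + 1)) (fun a => Polynomial.aeval x a)
      = X ^ (Fintype.card F) ^ (d + 1)
        - hlpP F x (d + 1) (x ^ (Fintype.card F) ^ (d + 1)) := by
  classical
  have hlt : (Fintype.card F) ^ d < (Fintype.card F) ^ (d + 1) :=
    Nat.pow_lt_pow_right (Fintype.one_lt_card) (Nat.lt_succ_self d)
  have hPd : (hlpP F x (d + 1) (x ^ (Fintype.card F) ^ (d + 1))).degree
      < ((Fintype.card F) ^ (d + 1) : ℕ) :=
    lt_of_le_of_lt degree_le_natDegree
      (by exact_mod_cast (hlpP_natDegree x d _).trans_lt hlt)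
  have hQm : (X ^ (Fintype.card F) ^ (d + 1)
        - hlpP F x (d + 1) (x ^ (Fintype.card F) ^ (d + 1))).Monic := by
    rw [sub_eq_add_neg]
    exact monic_X_pow_add (by rwa [degree_neg])
  have hQd : (X ^ (Fintype.card F) ^ (d + 1)
        - hlpP F x (d + 1) (x ^ (Fintype.card F) ^ (d + 1))).degree
          = (((Fintype.card F) ^ (d + 1) : ℕ) : WithBot ℕ) := by
    rw [degree_sub_eq_left_of_degree_lt] <;> rw [degree_X_pow]
    exact hPd
  refine Polynomial.eq_of_degree_sub_lt_of_eval_index_eq (hlpMon F (d + 1))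
    (v := fun a => Polynomial.aeval x a) hx.injOn ?_ ?_
  · have := Polynomial.degree_sub_lt_left
      (p := Lagrange.nodal (hlpMon F (d + 1)) (fun a => Polynomial.aeval x a))
      (q := X ^ (Fintype.card F) ^ (d + 1)
        - hlpP F x (d + 1) (x ^ (Fintype.card F) ^ (d + 1)))
      (by rw [hQd, Lagrange.degree_nodal, hlpMon_card])
      Lagrange.nodal_ne_zero (by rw [hQm.leadingCoeff, Lagrange.nodal_monic.leadingCoeff])
    rwa [Lagrange.degree_nodal] at this
  · intro a ha
    rw [Lagrange.eval_nodal_at_node ha, eval_sub, hlpP_eval x hx _ a ha, hlp_aeval_pow]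
    simp

theorem hlp_deriv (x : L) (d : ℕ) (t : L) :
    derivative (X ^ (Fintype.card F) ^ (d + 1) - hlpP F x (d + 1) t)
      = - C ((Lagrange.basis (Finset.range (d + 1))
          (fun i : ℕ => x ^ (Fintype.card F) ^ i) 0).eval t) := by
  have h0 : ((Fintype.card F : ℕ) : L) = 0 := by
    have := congrArg (algebraMap F L) (FiniteField.cast_card_eq_zero F)
    rwa [map_natCast, map_zero] at this
  have hX : ∀ i : ℕ, derivative (X ^ (Fintype.card F) ^ (i + 1) : L[X]) = 0 := by
    intro i
    rw [derivative_X_pow]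
    simp [h0]
  rw [hlpP, Finset.sum_range_succ']
  simp only [derivative_sub, derivative_add, derivative_sum, derivative_C_mul, hX, derivative_C]
  simp

/-- the key sum -/
theorem hlp_sum (x : L) (hx : Function.Injective (fun a : F[X] => Polynomial.aeval x a)) (n : ℕ)
    (hn : n ≤ Fintype.card F - 1) (t : Fin n → L) (d : ℕ) :
    ∑ a ∈ hlpMon F d, (∏ i, Polynomial.aeval (t i) a) / Polynomial.aeval x a
      = (∏ i, ∏ k ∈ Finset.range d, (t i - x ^ (Fintype.card F) ^ k))
        / ∏ k ∈ Finset.range d, (x - x ^ (Fintype.card F) ^ (k + 1)) := by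
  classical
  rcases d with _ | d
  · have : hlpMon F 0 = {1} := by
      ext a
      rw [hlpMon_mem, Finset.mem_singleton]
      constructor
      · rintro ⟨h1, h2⟩
        exact h1.natDegree_eq_zero.1 h2
      · rintro rfl
        simp
    simp [this]
  set y : ℕ → L := fun i => x ^ (Fintype.card F) ^ i with hy
  have hyinj : Function.Injective y := hlp_inj x hx
  have hq1 : 1 < Fintype.card F := Fintype.one_lt_card
  set v : F[X] → L := fun a => Polynomial.aeval x a with hv
  set P : L[X] := ∏ i, hlpP F x (d + 1) (t i) with hP
  have hPdeg : P.degree < (hlpMon F (d + 1)).card := by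
    rw [hlpMon_card]
    refine lt_of_le_of_lt degree_le_natDegree ?_
    have h1 : P.natDegree ≤ n * (Fintype.card F) ^ d := by
      refine (natDegree_prod_le _ _).trans ?_
      refine (Finset.sum_le_card_nsmul _ _ _ (fun i _ => hlpP_natDegree x d (t i))).trans ?_
      simp
    have h2 : n * (Fintype.card F) ^ d < (Fintype.card F) ^ (d + 1) := by
      rw [pow_succ']
      exact Nat.mul_lt_mul_of_pos_right (by omega) (pow_pos (by omega) _)
    exact_mod_cast h1.trans_lt h2
  have hPe : ∀ a ∈ hlpMon F (d + 1), P.eval (v a) = ∏ i, Polynomial.aeval (t i) a := by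
    intro a ha
    rw [hP, eval_prod]
    exact Finset.prod_congr rfl fun i _ => hlpP_eval x hx _ a ha _
  have hP0 : P.eval 0 = ∏ i, ∏ k ∈ Finset.range (d + 1), (t i - x ^ (Fintype.card F) ^ k) := by
    rw [hP, eval_prod]
    exact Finset.prod_congr rfl fun i _ => hlpP_eval_zero x _ _
  have hne : ∀ a ∈ hlpMon F (d + 1), (0 : L) ≠ v a := by
    intro a ha h
    rw [hlpMon_mem] at ha
    have : a = 0 := hx (by simpa [hv] using h.symm)
    exact ha.1.ne_zero this
  have hI := congrArg (Polynomial.eval 0)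
    (Lagrange.eq_interpolate_of_eval_eq _ (v := v) hx.injOn hPdeg hPe)
  rw [Lagrange.eval_interpolate_not_at_node _ hne, hP0] at hI
  set B : L := (Lagrange.basis (Finset.range (d + 1)) y 0).eval (y (d + 1)) with hB
  have hw : ∀ a ∈ hlpMon F (d + 1), Lagrange.nodalWeight (hlpMon F (d + 1)) v a = (-B)⁻¹ := by
    intro a ha
    rw [Lagrange.nodalWeight_eq_eval_derivative_nodal ha, hlp_nodal x hx, hlp_deriv]
    simp [hB, hy]
  have hN : (Lagrange.nodal (hlpMon F (d + 1)) v).eval 0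
      = - ∏ k ∈ Finset.range (d + 1), (y (d + 1) - y k) := by
    rw [hlp_nodal x hx, eval_sub, hlpP_eval_zero]
    simp [hy]
  rw [hN, Finset.sum_congr rfl (fun a ha => by rw [hw a ha])] at hI
  have hBv : B = ∏ k ∈ Finset.range d, ((x - y (k + 1))⁻¹ * (y (d + 1) - y (k + 1))) := by
    rw [hB, Lagrange.basis, eval_prod]
    have : (Finset.range (d + 1)).erase 0 = (Finset.range d).image (· + 1) := by
      ext k
      rcases k with _ | k <;> simp
    rw [this, Finset.prod_image (by intro a _ b _ h; simpa using h)]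
    refine Finset.prod_congr rfl fun k _ => ?_
    simp [Lagrange.basisDivisor, hy]
  have hsum : ∑ a ∈ hlpMon F (d + 1), (-B)⁻¹ * (0 - v a)⁻¹ * ∏ i, Polynomial.aeval (t i) a
      = B⁻¹ * ∑ a ∈ hlpMon F (d + 1), (∏ i, Polynomial.aeval (t i) a) / Polynomial.aeval x a := by
    rw [Finset.mul_sum]
    refine Finset.sum_congr rfl fun a _ => ?_
    rw [zero_sub, inv_neg, inv_neg, div_eq_mul_inv]
    ring
  rw [hsum] at hI
  have hx1 : ∀ k, x - y (k + 1) ≠ 0 := by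
    intro k h
    have : y 0 = y (k + 1) := by rw [← sub_eq_zero, ← h]; simp [hy]
    exact absurd (hyinj this) (by simp)
  have hy1 : ∀ k ∈ Finset.range (d + 1), y (d + 1) - y k ≠ 0 := by
    intro k hk h
    have := hyinj (sub_eq_zero.1 h)
    simp at hk
    omega
  have hA : ∏ k ∈ Finset.range d, (x - y (k + 1)) ≠ 0 :=
    Finset.prod_ne_zero_iff.2 fun k _ => hx1 k
  have hY : ∏ k ∈ Finset.range d, (y (d + 1) - y (k + 1)) ≠ 0 :=
    Finset.prod_ne_zero_iff.2 fun k hk => hy1 _ (by simpa using hk)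
  have hxd := hx1 d
  rw [Finset.prod_range_succ' (fun k => y (d + 1) - y k), hBv, Finset.prod_mul_distrib,
    Finset.prod_inv_distrib] at hI
  have hy0 : y 0 = x := by simp [hy]
  rw [hy0] at hI
  change _ = _ / ∏ k ∈ Finset.range (d + 1), (x - y (k + 1))
  rw [Finset.prod_range_succ (fun k => x - y (k + 1)), hI]
  field_simp
  ring

/-- sum of inverse products -/
theorem hlp_weights (y : ℕ → L) (hy : Function.Injective y) (m : ℕ) :
    ∑ p ∈ Finset.HasAntidiagonal.antidiagonal (m + 1),
      ((∏ k ∈ Finset.range p.1, (y p.1 - y k)) *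
        ∏ k ∈ Finset.range p.2, (y p.1 - y (p.1 + (k + 1))))⁻¹ = 0 := by
  classical
  have h := Lagrange.coeff_eq_sum (s := Finset.range (m + 2)) (v := y) hy.injOn
    (P := 1) (by rw [degree_one]; simp; exact_mod_cast Nat.succ_pos _)
  have h0 : (1 : L[X]).coeff ((Finset.range (m + 2)).card - 1) = 0 := by
    rw [Finset.card_range, Polynomial.coeff_one]; simp
  rw [h0] at h
  rw [Finset.Nat.sum_antidiagonal_eq_sum_range_succ_mk, h]
  refine Finset.sum_congr rfl fun j hj => ?_
  rw [eval_one, one_div]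
  congr 1
  have hj' : j < m + 2 := by simpa using hj
  have : (Finset.range (m + 2)).erase j
      = Finset.range j ∪ (Finset.range (m + 1 - j)).image (fun k => j + (k + 1)) := by
    ext k
    simp only [Finset.mem_erase, Finset.mem_range, Finset.mem_union, Finset.mem_image]
    constructor
    · rintro ⟨h1, h2⟩
      rcases lt_or_gt_of_ne h1 with h | h
      · exact Or.inl h
      · exact Or.inr ⟨k - j - 1, by omega, by omega⟩
    · rintro (h | ⟨l, h1, rfl⟩) <;> omega
  rw [this, Finset.prod_union, Finset.prod_image]
  · intro a _ b _ h
    simpa using h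
  · rw [Finset.disjoint_left]
    intro k hk hk'
    simp only [Finset.mem_range, Finset.mem_image] at hk hk'
    obtain ⟨l, _, rfl⟩ := hk'
    omega

/-- The block `j + deg a = m` in the field. -/
theorem hlp_block (x : L) (hx : Function.Injective (fun a : F[X] => Polynomial.aeval x a)) (n : ℕ)
    (hn : n ≤ Fintype.card F - 1) (t : Fin n → L)
    (D : ℕ → F[X]) (hD0 : D 0 = 1)
    (hD : ∀ i : ℕ, D (i + 1) = (X ^ (Fintype.card F) ^ (i + 1) - X) * (D i) ^ (Fintype.card F))
    (g : ℕ → F[X] → L)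
    (hg : ∀ j a, a.Monic → Polynomial.aeval x (D j)
        * (Polynomial.aeval x a) ^ (Fintype.card F) ^ j * g j a
      = (∏ i, ∏ k ∈ Finset.range j, (t i - x ^ (Fintype.card F) ^ k))
        * ∏ i, Polynomial.aeval (t i) a) (m : ℕ) :
    ∑ p ∈ Finset.HasAntidiagonal.antidiagonal (m + 1), ∑ a ∈ hlpMon F p.2, g p.1 a = 0 := by
  classical
  set y : ℕ → L := fun i => x ^ (Fintype.card F) ^ i with hy
  have hyinj : Function.Injective y := hlp_inj x hx
  have hDv : ∀ j, Polynomial.aeval x (D j) = ∏ k ∈ Finset.range j, (y j - y k) := by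
    intro j
    induction j with
    | zero => simp [hD0]
    | succ j ih =>
      rw [hD, map_mul, map_pow, ih, Finset.prod_range_succ', mul_comm, ← Finset.prod_pow]
      congr 1
      · refine Finset.prod_congr rfl fun k _ => ?_
        rw [hlp_sub_pow]
        simp only [hy, ← pow_mul, ← pow_succ]
      · simp [hy]
  have hDne : ∀ j, Polynomial.aeval x (D j) ≠ 0 := by
    intro j
    rw [hDv, Finset.prod_ne_zero_iff]
    intro k hk h
    have := hyinj (sub_eq_zero.1 h)
    simp at hk
    omega
  have hane : ∀ a : F[X], a.Monic → Polynomial.aeval x a ≠ 0 := fun a ha h =>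
    ha.ne_zero (hx (by simpa using h))
  have hinner : ∀ p ∈ Finset.HasAntidiagonal.antidiagonal (m + 1), ∑ a ∈ hlpMon F p.2, g p.1 a
      = (∏ i, ∏ k ∈ Finset.range (m + 1), (t i - y k)) *
        ((∏ k ∈ Finset.range p.1, (y p.1 - y k)) *
        ∏ k ∈ Finset.range p.2, (y p.1 - y (p.1 + (k + 1))))⁻¹ := by
    rintro ⟨j, d⟩ hp
    have hjd : j + d = m + 1 := by simpa using hp
    simp only
    have hxj : Function.Injective (fun a : F[X] => Polynomial.aeval (y j) a) := by
      refine (injective_iff_map_eq_zero (Polynomial.aeval (R := F) (y j))).2 ?_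
      intro a ha
      rw [hy, hlp_aeval_pow] at ha
      exact hx (by simpa using eq_zero_of_pow_eq_zero ha)
    have hs := hlp_sum (F := F) (y j) hxj n hn t d
    have hyy : ∀ k, y j ^ (Fintype.card F) ^ k = y (j + k) := by
      intro k
      simp only [hy, ← pow_mul, ← pow_add]
    simp only [hyy] at hs
    have h1 : ∀ a ∈ hlpMon F d, g j a = ((∏ i, ∏ k ∈ Finset.range j, (t i - y k))
        * (Polynomial.aeval x (D j))⁻¹) *
        ((∏ i, Polynomial.aeval (t i) a) / Polynomial.aeval (y j) a) := by
      intro a ha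
      have ham := ((hlpMon_mem d a).1 ha).1
      have h2 := hg j a ham
      have h3 := hane a ham
      have h4 := hDne j
      have h5 : Polynomial.aeval (y j) a = (Polynomial.aeval x a) ^ (Fintype.card F) ^ j :=
        hlp_aeval_pow x a j
      rw [h5]
      have h6 : (Polynomial.aeval x a) ^ (Fintype.card F) ^ j ≠ 0 := pow_ne_zero _ h3
      generalize (Polynomial.aeval x a) ^ (Fintype.card F) ^ j = z at *
      field_simp
      rw [← h2]
      ring
    rw [Finset.sum_congr rfl h1, ← Finset.mul_sum, hs, hDv, ← hjd]
    simp only [Finset.prod_range_add, Finset.prod_mul_distrib]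
    rw [mul_inv, div_eq_mul_inv]
    ring
  rw [Finset.sum_congr rfl hinner, ← Finset.mul_sum, hlp_weights y hyinj, mul_zero]

theorem hlp_algMap (F : Type*) [Field F] (n : ℕ) (c : F) :
    algebraMap F (LaurentSeries (MvPolynomial (Fin n) F)) c
      = HahnSeries.C (MvPolynomial.C c) := by
  rw [HahnSeries.algebraMap_apply', PowerSeries.algebraMap_apply, HahnSeries.ofPowerSeries_C]
  rfl

end Helpers

/-- Let `0 ≤ n ≤ q−1`, `φ` the canonical deformation of the
Carlitz module, `φ_θ = (t₁−θ)⋯(t_n−θ)τ + θ`, with exponential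
`exp_φ = Σ_{j≥0} b_j(t₁)⋯b_j(t_n) τ^j / D_j`, and let
`𝓛 = Σ_{a monic} a(t₁)⋯a(t_n)/a` be the `L`-series, convergent in the Tate
algebra `T_n(K_∞)`.  Then `exp_φ(𝓛) = 1`.

Since `τ^j(𝓛) = Σ_{a monic} a(t₁)⋯a(t_n)/a^{q^j}`, the element `exp_φ(𝓛)` is
the sum of the summable family indexed by pairs `(j, a)` (`j ≥ 0`, `a` monic)
with terms `b_j(t₁)⋯b_j(t_n)·a(t₁)⋯a(t_n)/(D_j·a^{q^j})`; the family `G` below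
is characterized by exactly these terms (the Tate algebra being a domain). -/
theorem exp_of_L_series_eq_one
    (Fq : Type*) [Field Fq] [Fintype Fq]
    (q : ℕ) (hq : q = Fintype.card Fq)
    (n : ℕ) (hn : n ≤ q - 1)
    (D : ℕ → Polynomial Fq) (hD0 : D 0 = 1)
    (hD : ∀ i : ℕ, D (i + 1) =
      (Polynomial.X ^ q ^ (i + 1) - Polynomial.X) * (D i) ^ q)
    (G : HahnSeries.SummableFamily ℤ (MvPolynomial (Fin n) Fq)
      (ℕ × Polynomial Fq))
    (hG : ∀ (j : ℕ) (a : Polynomial Fq), a.Monic →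
      polyToTate Fq n (D j) * (polyToTate Fq n a) ^ q ^ j * G (j, a) =
        tateBProd Fq n q j * tateAProd Fq n a)
    (hG' : ∀ (j : ℕ) (a : Polynomial Fq), ¬ a.Monic → G (j, a) = 0) :
    G.hsum = 1 := by
  classical
  subst hq
  let R := LaurentSeries (MvPolynomial (Fin n) Fq)
  let L := FractionRing R
  let ι : R →ₐ[Fq] L := IsScalarTower.toAlgHom Fq R L
  have hι : Function.Injective ι := IsFractionRing.injective R L
  -- transcendence of θ
  have hθ : Function.Injective (fun a : Fq[X] => Polynomial.aeval (thetaTate Fq n) a) := by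
    refine (injective_iff_map_eq_zero (Polynomial.aeval (R := Fq) (thetaTate Fq n))).2 ?_
    intro a ha
    ext k
    have h1 := congrArg (fun f : R => f.coeff (-(k : ℤ))) ha
    have hpow : ∀ i : ℕ, (thetaTate Fq n) ^ i
        = HahnSeries.single (-(i : ℤ)) (1 : MvPolynomial (Fin n) Fq) := by
      intro i
      rw [thetaTate, HahnSeries.single_pow]
      simp
    simp only [Polynomial.aeval_def, Polynomial.eval₂_eq_sum_range, hpow] at h1
    rw [HahnSeries.coeff_sum] at h1
    have hc : ∀ i : ℕ, (algebraMap Fq (LaurentSeries (MvPolynomial (Fin n) Fq)) (a.coeff i) * HahnSeries.single (-(i : ℤ)) 1).coeff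
        (-(k : ℤ)) = if k = i then MvPolynomial.C (a.coeff i) else 0 := by
      intro i
      rw [hlp_algMap, HahnSeries.C_apply, HahnSeries.coeff_single_zero_mul, HahnSeries.coeff_single]
      simp
    rw [Finset.sum_congr rfl (fun i _ => hc i)] at h1
    by_cases hk : k ∈ Finset.range (a.natDegree + 1)
    · rw [Finset.sum_ite_eq, if_pos hk] at h1
      simpa using h1
    · rw [Polynomial.coeff_eq_zero_of_natDegree_lt (by simpa using hk)]
      simp
  have hx : Function.Injective (fun a : Fq[X] => Polynomial.aeval (ι (thetaTate Fq n)) a) := by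
    intro a b h
    simp only [Polynomial.aeval_algHom_apply] at h
    exact hθ (hι h)
  have hblock : ∀ m : ℕ, ∑ p ∈ Finset.HasAntidiagonal.antidiagonal (m + 1),
      ∑ a ∈ hlpMon Fq p.2, G (p.1, a) = 0 := by
    intro m
    apply hι
    rw [map_zero, map_sum]
    simp only [map_sum]
    refine hlp_block (ι (thetaTate Fq n)) hx n hn
      (fun i => ι (HahnSeries.C (MvPolynomial.X i))) D hD0 hD (fun j a => ι (G (j, a))) ?_ m
    intro j a ha
    have h := congrArg ι (hG j a ha)
    rw [polyToTate, polyToTate, tateBProd, tateAProd] at h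
    simp only [map_mul, map_pow, map_prod, map_sub] at h
    simp only [Polynomial.aeval_algHom_apply]
    rw [h]
    congr 1
    refine Finset.prod_congr rfl fun i _ => ?_
    congr 1
    have : (HahnSeries.C (Polynomial.aeval (MvPolynomial.X i : MvPolynomial (Fin n) Fq) a) : R)
      = Polynomial.aeval (HahnSeries.C (MvPolynomial.X i) : R) a := by
      rw [Polynomial.aeval_def, Polynomial.aeval_def, Polynomial.hom_eval₂]
      congr 1
      ext1 c
      exact (hlp_algMap Fq n c).symm
    exact this
  have h00 : G (0, 1) = 1 := by
    have h := hG 0 1 monic_one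
    simpa [hD0, polyToTate, tateBProd, tateAProd] using h
  ext1
  funext g
  have hfin : {p | (G p).coeff g ≠ 0}.Finite := G.finite_co_support g
  set T := hfin.toFinset with hT
  set M := T.sup (fun p => p.1 + p.2.natDegree) with hM
  set Blk : ℕ → Finset (ℕ × Fq[X]) := fun m =>
    (Finset.HasAntidiagonal.antidiagonal m).biUnion fun p => {p.1} ×ˢ hlpMon Fq p.2 with hBlk
  have hmem : ∀ m p, p ∈ Blk m ↔ p.2.Monic ∧ p.1 + p.2.natDegree = m := by
    rintro m ⟨j, a⟩
    simp only [hBlk, Finset.mem_biUnion, Finset.mem_product, Finset.mem_singleton, hlpMon_mem,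
      Finset.HasAntidiagonal.mem_antidiagonal, Prod.exists]
    constructor
    · rintro ⟨j', d, h1, rfl, h2, rfl⟩
      exact ⟨h2, h1⟩
    · rintro ⟨h1, h2⟩
      exact ⟨j, _, h2, rfl, h1, rfl⟩
  have hsub : {p | (G p).coeff g ≠ 0} ⊆ (((Finset.range (M + 1)).biUnion Blk : Finset _) : Set _) := by
    rintro ⟨j, a⟩ hp
    have hpT : (j, a) ∈ T := by
      rw [hT, Set.Finite.mem_toFinset]
      exact hp
    have ham : a.Monic := by
      by_contra h
      apply hp
      rw [hG' j a h]
      rfl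
    have hle : j + a.natDegree ≤ M :=
      Finset.le_sup (f := fun p : ℕ × Fq[X] => p.1 + p.2.natDegree) hpT
    simp only [Finset.coe_biUnion, Set.mem_iUnion, Finset.mem_coe, Finset.mem_range]
    exact ⟨_, Nat.lt_succ_of_le hle, (hmem _ _).2 ⟨ham, rfl⟩⟩
  have hBsum : ∀ m, ∑ p ∈ Blk m, G p
      = ∑ p ∈ Finset.HasAntidiagonal.antidiagonal m, ∑ a ∈ hlpMon Fq p.2, G (p.1, a) := by
    intro m
    rw [hBlk, Finset.sum_biUnion]
    · refine Finset.sum_congr rfl fun p _ => ?_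
      rw [Finset.sum_product, Finset.sum_singleton]
    · rintro ⟨j, d⟩ _ ⟨j', d'⟩ _ hne
      rw [Function.onFun, Finset.disjoint_left]
      rintro ⟨k, a⟩ h1 h2
      simp only [Finset.mem_product, Finset.mem_singleton, hlpMon_mem] at h1 h2
      apply hne
      rw [← h1.1, ← h2.1, ← h1.2.2, ← h2.2.2]
  rw [HahnSeries.SummableFamily.coeff_hsum_eq_sum_of_subset hsub, ← HahnSeries.coeff_sum,
    Finset.sum_biUnion]
  · rw [Finset.sum_range_succ', Finset.sum_eq_zero (fun m _ => by rw [hBsum, hblock]), zero_add]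
    have hB0 : Blk 0 = {(0, 1)} := by
      ext ⟨j, a⟩
      rw [hmem, Finset.mem_singleton, Prod.mk.injEq]
      constructor
      · rintro ⟨h1, h2⟩
        simp only at h1 h2
        exact ⟨by omega, h1.natDegree_eq_zero.1 (by omega)⟩
      · rintro ⟨rfl, rfl⟩
        simp
    rw [hB0, Finset.sum_singleton, h00]
  · intro m _ m' _ hne
    rw [Function.onFun, Finset.disjoint_left]
    intro p h1 h2
    rw [hmem] at h1 h2
    exact hne (h1.2.symm.trans h2.2)
end

section
/- Let n ≥ q with n ≡ 1 (mod q−1). Then u_C(t₁,…,t_n;1) = 0, i.e. exp_φ(𝓛(φ/𝔸)) = 0, where φ is the canonical deformation of the Carlitz module over the Tate algebra T_n(K_∞) and 𝓛(φ/𝔸) = Σ_{a monic in A} a(t₁)⋯a(t_n)/a. -/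
open Polynomial

/-- The `k`-th power of the `q`-Frobenius. -/
noncomputable def frq (Fq : Type*) [Field Fq] [Fintype Fq] (R : Type*) [CommRing R] [Algebra Fq R]
    (k : ℕ) : R →ₐ[Fq] R := (FiniteField.frobeniusAlgHom Fq R) ^ k

theorem frq_apply {Fq : Type*} [Field Fq] [Fintype Fq] {R : Type*} [CommRing R] [Algebra Fq R]
    (q : ℕ) (hq : q = Fintype.card Fq) (k : ℕ) (x : R) : frq Fq R k x = x ^ q ^ k := by
  subst hq
  rw [frq, AlgHom.coe_pow, FiniteField.coe_frobeniusAlgHom, pow_iterate]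

theorem frq_add_pow (Fq : Type*) [Field Fq] [Fintype Fq] {R : Type*} [CommRing R] [Algebra Fq R]
    (q : ℕ) (hq : q = Fintype.card Fq) (k : ℕ) (x y : R) :
    (x + y) ^ q ^ k = x ^ q ^ k + y ^ q ^ k := by
  simp only [← frq_apply q hq, map_add]

theorem frq_sub_pow (Fq : Type*) [Field Fq] [Fintype Fq] {R : Type*} [CommRing R] [Algebra Fq R]
    (q : ℕ) (hq : q = Fintype.card Fq) (k : ℕ) (x y : R) :
    (x - y) ^ q ^ k = x ^ q ^ k - y ^ q ^ k := by
  simp only [← frq_apply q hq, map_sub]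

theorem C_pow_q {Fq : Type*} [Field Fq] [Fintype Fq]
    (q : ℕ) (hq : q = Fintype.card Fq) (k : ℕ) (c : Fq) :
    (C c : Fq[X]) ^ q ^ k = C c := by
  have := (frq Fq Fq[X] k).commutes c
  rw [frq_apply q hq] at this
  exact this

theorem carlitz_exists {Fq : Type*} [Field Fq] [Fintype Fq]
    (q : ℕ) (hq : q = Fintype.card Fq) (n : ℕ)
    (e : ℕ → FractionRing Fq[X]) (he0 : e 0 = 1)
    (he : ∀ j, e j ^ q = algebraMap Fq[X] _ (X ^ q ^ (j + 1) - X) * e (j + 1)) :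
    ∀ (N : ℕ) (a : Fq[X]), a.natDegree ≤ N → ∃ p : ℕ → Fq[X], p 0 = a ∧ p N = C (a.coeff N) ∧
      (∀ k, N < k → p k = 0) ∧
      (∀ k, (X ^ q ^ (k + 1) - X) * p (k + 1) = p k ^ q - p k) ∧
      (∀ i : Fin n, aeval (MvPolynomial.X i : MvPolynomial (Fin n) Fq[X]) a =
        ∑ k ∈ Finset.range (N + 1), MvPolynomial.C (p k) *
          ∏ l ∈ Finset.range k, (MvPolynomial.X i - MvPolynomial.C (X ^ q ^ l))) ∧
      (∀ k, ∑ ij ∈ Finset.HasAntidiagonal.antidiagonal k, algebraMap Fq[X] (FractionRing Fq[X]) (p ij.1) *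
        (e ij.2) ^ q ^ ij.1 = algebraMap Fq[X] (FractionRing Fq[X]) (a ^ q ^ k) * e k) := by
  intro N
  have hq1 : 1 < q := hq ▸ Fintype.one_lt_card
  induction N with
  | zero =>
    intro a ha
    obtain ⟨c, rfl⟩ : ∃ c, a = C c := ⟨_, Polynomial.eq_C_of_natDegree_le_zero ha⟩
    have hcq := C_pow_q q hq 1 c
    rw [pow_one] at hcq
    refine ⟨fun k => if k = 0 then C c else 0, by simp, by simp, ?_, ?_, ?_, ?_⟩
    · intro k hk; simp; omega
    · intro k
      rcases k with _ | k
      · simp [hcq]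
      · simp
        rw [zero_pow (by omega)]
    · intro i
      simp
    · intro k
      rw [Finset.sum_eq_single (0, k)]
      · simp only [if_true, pow_zero, pow_one, C_pow_q q hq]
      · rintro ⟨i, j⟩ hij hne
        simp only [Finset.HasAntidiagonal.mem_antidiagonal] at hij
        have : i ≠ 0 := by
          rintro rfl
          apply hne
          simp at hij
          simp [hij]
        simp [this]
      · simp
  | succ N ih =>
    intro a ha
    obtain ⟨p, h0, hN, hz, hr, hb, hx⟩ := ih a.divX (by
      rw [Polynomial.natDegree_divX_eq_natDegree_tsub_one]; omega)
    set c := a.coeff 0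
    have haX : a = X * a.divX + C c := (Polynomial.X_mul_divX_add a).symm
    have hcq : ∀ k, (C c : Fq[X]) ^ q ^ k = C c := fun k => C_pow_q q hq k c
    let P : ℕ → Fq[X] := fun k => (match k with | 0 => C c | k + 1 => p k) + X ^ q ^ k * p k
    have P0 : P 0 = C c + X * p 0 := by simp [P]
    have PS : ∀ k, P (k + 1) = p k + X ^ q ^ (k + 1) * p (k + 1) := fun k => rfl
    refine ⟨P, ?_, ?_, ?_, ?_, ?_, ?_⟩
    · rw [P0, h0, add_comm]; exact haX.symm
    · rw [PS, hN, hz _ (Nat.lt_succ_self N), Polynomial.coeff_divX]; simp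
    · intro k hk
      obtain ⟨k, rfl⟩ : ∃ l, k = l + 1 := ⟨k - 1, by omega⟩
      rw [PS, hz _ (by omega), hz _ (by omega)]; simp
    · intro k
      have hadd := fun x y : Fq[X] => frq_add_pow Fq q hq 1 x y
      have hc1 := hcq 1
      simp only [pow_one] at hadd hc1
      rcases k with _ | k
      · rw [PS, P0, hadd, mul_pow, hc1]
        have := hr 0
        simp only [zero_add, pow_one] at this ⊢
        linear_combination X ^ q * this
      · rw [PS, PS, hadd, mul_pow, ← pow_mul, ← pow_succ]
        have h1 := hr k
        have h2 := hr (k + 1)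
        linear_combination h1 + X ^ q ^ (k + 1 + 1) * h2
    · intro i
      rw [Finset.sum_range_succ']
      simp only [PS, P0]
      conv_lhs => rw [haX]
      rw [map_add, map_mul, hb i]
      simp only [aeval_X, Finset.prod_range_zero, mul_one, map_add, map_mul, add_mul,
        Finset.sum_add_distrib, Finset.prod_range_succ]
      have e1 : aeval (MvPolynomial.X i : MvPolynomial (Fin n) Fq[X]) (C c) = MvPolynomial.C (C c) := by
        simp
      rw [e1]
      have e2 : ∑ k ∈ Finset.range (N + 1), (MvPolynomial.C (X ^ q ^ (k + 1)) : MvPolynomial (Fin n) Fq[X]) *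
          MvPolynomial.C (p (k + 1)) * ((∏ l ∈ Finset.range k, (MvPolynomial.X i - MvPolynomial.C (X ^ q ^ l))) * (MvPolynomial.X i - MvPolynomial.C (X ^ q ^ k))) + MvPolynomial.C X * MvPolynomial.C (p 0) = ∑ k ∈ Finset.range (N + 1), (MvPolynomial.C (X ^ q ^ k)) *
          MvPolynomial.C (p k) * (∏ l ∈ Finset.range k, (MvPolynomial.X i - MvPolynomial.C (X ^ q ^ l))) := by
        have := Finset.sum_range_succ' (fun k => (MvPolynomial.C (X ^ q ^ k)) *
          MvPolynomial.C (p k) * (∏ l ∈ Finset.range k, (MvPolynomial.X i - MvPolynomial.C (X ^ q ^ l))) : ℕ → MvPolynomial (Fin n) Fq[X]) (N + 1)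
        rw [Finset.sum_range_succ, hz (N + 1) (by omega)] at this
        simp only [map_zero, mul_zero, zero_mul, add_zero, Finset.prod_range_succ, pow_zero, pow_one, Finset.prod_range_zero, mul_one] at this
        exact this.symm
      rw [add_comm (MvPolynomial.C (C c)), ← add_assoc, add_assoc (∑ x ∈ Finset.range (N + 1), _) _ (MvPolynomial.C X * _), e2, Finset.mul_sum, ← Finset.sum_add_distrib]
      congr 1
      refine Finset.sum_congr rfl fun k _ => ?_
      ring
    · intro k
      have key : algebraMap Fq[X] (FractionRing Fq[X]) (a ^ q ^ k) =
          algebraMap Fq[X] _ (C c) + algebraMap Fq[X] _ (X ^ q ^ k) * algebraMap Fq[X] _ (a.divX ^ q ^ k) := by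
        conv_lhs => rw [haX]
        rw [frq_add_pow Fq q hq, hcq, mul_pow, map_add, map_mul, add_comm]
      rw [key, add_mul, mul_assoc, ← hx k]
      rcases k with _ | k
      · simp [P0, he0]
      · let Q : ℕ → Fq[X] := fun k => match k with | 0 => C c | k + 1 => p k
        have hP : ∀ k, P k = Q k + X ^ q ^ k * p k := fun k => rfl
        simp only [hP, map_add, add_mul, Finset.sum_add_distrib]
        have s1 : ∑ ij ∈ Finset.HasAntidiagonal.antidiagonal (k + 1),
            algebraMap Fq[X] (FractionRing Fq[X]) (Q ij.1) * (e ij.2) ^ q ^ ij.1 =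
            algebraMap _ _ (C c) * e (k + 1) + ∑ ij ∈ Finset.HasAntidiagonal.antidiagonal k,
              algebraMap Fq[X] (FractionRing Fq[X]) (p ij.1) * (e ij.2) ^ q ^ (ij.1 + 1) := by
          rw [Finset.Nat.antidiagonal_succ, Finset.sum_cons, Finset.sum_map]
          simp [Q]
        have s2 : ∀ g : ℕ → ℕ → FractionRing Fq[X],
            ∑ ij ∈ Finset.HasAntidiagonal.antidiagonal (k + 1), g ij.1 ij.2 =
            g (k + 1) 0 + ∑ ij ∈ Finset.HasAntidiagonal.antidiagonal k, g ij.1 (ij.2 + 1) := by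
          intro g
          rw [Finset.Nat.antidiagonal_succ', Finset.sum_cons, Finset.sum_map]
          simp
        rw [s1, s2 (fun i j => algebraMap Fq[X] (FractionRing Fq[X]) (X ^ q ^ i * p i) * e j ^ q ^ i),
          s2 (fun i j => algebraMap Fq[X] (FractionRing Fq[X]) (p i) * e j ^ q ^ i)]
        rw [mul_add, Finset.mul_sum, add_assoc]
        congr 1
        rw [add_left_comm, ← Finset.sum_add_distrib, he0]
        congr 1
        · simp
        refine Finset.sum_congr rfl ?_
        rintro ⟨i, j⟩ hij
        simp only [Finset.HasAntidiagonal.mem_antidiagonal] at hij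
        subst hij
        dsimp only
        rw [pow_succ' q i, pow_mul (e j), he j, mul_pow, ← map_pow, frq_sub_pow Fq q hq, ← pow_mul, ← pow_add]
        simp only [map_sub, map_mul]
        rw [show j + 1 + i = i + j + 1 by ring]
        ring

section ADivis
variable {Fq : Type*} [Field Fq] [Fintype Fq]

theorem pow_frob_sub_dvd (q : ℕ) (hq : q = Fintype.card Fq) {P : Fq[X]} (hP : Irreducible P) (c : Fq[X]) :
    P ∣ c ^ q ^ P.natDegree - c := by
  have h1 : P ∣ X ^ q ^ P.natDegree - X := by
    have := (hP.natDegree_dvd_iff_dvd_X_pow_card_pow_sub_X (n := P.natDegree)).1 dvd_rfl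
    rwa [Nat.card_eq_fintype_card, ← hq] at this
  have h2 : c ^ q ^ P.natDegree = aeval (X ^ q ^ P.natDegree : Fq[X]) c := by
    rw [← frq_apply q hq, ← frq_apply q hq, aeval_algHom_apply, aeval_X_left_apply]
  have h3 : c = aeval (X : Fq[X]) c := (aeval_X_left_apply c).symm
  refine h1.trans ?_
  rw [h2]
  have h4 := Polynomial.sub_dvd_eval_sub (X ^ q ^ P.natDegree) (X : Fq[X]) (c.map C)
  rw [eval_map, eval_map] at h4
  have h5 : eval₂ C (X : Fq[X]) c = c := by simp
  rw [h5] at h4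
  exact h4

theorem bracket_not_dvd (q : ℕ) (hq : q = Fintype.card Fq) {P : Fq[X]} (hP : Irreducible P) {k : ℕ} (hk : 0 < k)
    (hk2 : k < P.natDegree) : ¬ P ∣ X ^ q ^ k - X := by
  intro h
  rw [hq, ← Nat.card_eq_fintype_card] at h
  have := hP.natDegree_dvd_of_dvd_X_pow_card_pow_sub_X h
  exact absurd (Nat.le_of_dvd hk this) (by omega)

theorem bracket_factor (q : ℕ) (hq : q = Fintype.card Fq) {P : Fq[X]} (hP : Irreducible P) (k : ℕ) :
    ∃ e s, e ≤ 1 ∧ ¬ P ∣ s ∧ (X ^ q ^ (k + 1) - X : Fq[X]) = P ^ e * s := by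
  by_cases h : P ∣ X ^ q ^ (k + 1) - X
  · obtain ⟨s, hs⟩ := h
    refine ⟨1, s, le_rfl, ?_, by simpa using hs⟩
    intro hs'
    have hsep : (X ^ q ^ (k + 1) - X : Fq[X]).Separable := by
      obtain ⟨p, hp⟩ := CharP.exists Fq
      refine galois_poly_separable p _ ?_
      have : p ∣ q := by
        rw [← CharP.cast_eq_zero_iff Fq p, hq, Nat.cast_card_eq_zero]
      exact dvd_pow this (by omega)
    have hsq := hsep.squarefree
    refine hP.not_isUnit (hsq P ?_)
    rw [hs]
    exact mul_dvd_mul_left P hs'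
  · exact ⟨0, _, by omega, h, by simp⟩

theorem D_factor (q : ℕ) (hq : q = Fintype.card Fq) {P : Fq[X]} (hP : Irreducible P) (D : ℕ → Fq[X]) (hD0 : D 0 = 1)
    (hD : ∀ i : ℕ, D (i + 1) = (X ^ q ^ (i + 1) - X) * (D i) ^ q) (k : ℕ) :
    ∃ e s, e + 1 ≤ q ^ k ∧ ¬ P ∣ s ∧ D k = P ^ e * s := by
  have hq1 : 1 < q := hq ▸ Fintype.one_lt_card
  induction k with
  | zero =>
    refine ⟨0, 1, by simp, ?_, by simp [hD0]⟩
    intro h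
    exact hP.not_isUnit (isUnit_of_dvd_one h)
  | succ k ih =>
    obtain ⟨e, s, he, hs, h⟩ := ih
    obtain ⟨e', s', he', hs', h'⟩ := bracket_factor q hq hP k
    refine ⟨e' + e * q, s' * s ^ q, ?_, ?_, ?_⟩
    · rw [pow_succ]
      have := Nat.mul_le_mul_right q he
      nlinarith
    · intro hh
      rcases hP.prime.dvd_or_dvd hh with h1 | h1
      · exact hs' h1
      · exact hs (hP.prime.dvd_of_dvd_pow h1)
    · rw [hD, h', h]; ring

end ADivis

section Integrality
variable {Fq : Type*} [Field Fq] [Fintype Fq] {n : ℕ}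

/-- Inclusion `A[t] → K[t]`. -/
noncomputable def iotaT (Fq : Type*) [Field Fq] (n : ℕ) :
    MvPolynomial (Fin n) Fq[X] →+* MvPolynomial (Fin n) (FractionRing Fq[X]) :=
  MvPolynomial.map (algebraMap Fq[X] (FractionRing Fq[X]))

/-- scalars -/
noncomputable def kapT (Fq : Type*) [Field Fq] (n : ℕ) :
    Fq[X] →+* MvPolynomial (Fin n) (FractionRing Fq[X]) :=
  (iotaT Fq n).comp MvPolynomial.C

/-- The operator `τ^j`. -/
noncomputable def tauT (Fq : Type*) [Field Fq] [Fintype Fq] (R : Type*) [CommRing R] [Algebra Fq R]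
    (n : ℕ) (j : ℕ) : MvPolynomial (Fin n) R →+* MvPolynomial (Fin n) R :=
  MvPolynomial.map (frq Fq R j : R →+* R)

theorem tauT_C (q : ℕ) (hq : q = Fintype.card Fq) {R : Type*} [CommRing R] [Algebra Fq R] (j : ℕ)
    (x : R) : tauT Fq R n j (MvPolynomial.C x) = MvPolynomial.C (x ^ q ^ j) := by
  simp [tauT, frq_apply q hq]

theorem tauT_X {R : Type*} [CommRing R] [Algebra Fq R] (j : ℕ)
    (i : Fin n) : tauT Fq R n j (MvPolynomial.X i) = MvPolynomial.X i := by
  simp [tauT]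

theorem tauT_tauT {R : Type*} [CommRing R] [Algebra Fq R] (i j : ℕ)
    (x : MvPolynomial (Fin n) R) : tauT Fq R n i (tauT Fq R n j x) = tauT Fq R n (i + j) x := by
  rw [tauT, tauT, tauT, MvPolynomial.map_map]
  congr 1
  apply MvPolynomial.ringHom_ext
  · intro y
    simp [frq, pow_add]
  · intro y
    simp

theorem tauT_zero {R : Type*} [CommRing R] [Algebra Fq R]
    (x : MvPolynomial (Fin n) R) : tauT Fq R n 0 x = x := by
  have : ((frq Fq R 0 : R →ₐ[Fq] R) : R →+* R) = RingHom.id R := by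
    ext y
    simp [frq]
  rw [tauT, this, MvPolynomial.map_id]

theorem tauT_iota (j : ℕ) (x : MvPolynomial (Fin n) Fq[X]) :
    tauT Fq (FractionRing Fq[X]) n j (iotaT Fq n x) = iotaT Fq n (tauT Fq Fq[X] n j x) := by
  rw [tauT, tauT, iotaT, MvPolynomial.map_map, MvPolynomial.map_map]
  congr 1
  apply MvPolynomial.ringHom_ext
  · intro y
    simp [frq_apply _ rfl]
  · intro y
    simp

theorem tauT_kap (q : ℕ) (hq : q = Fintype.card Fq) (j : ℕ) (s : Fq[X]) :
    tauT Fq (FractionRing Fq[X]) n j (kapT Fq n s) = kapT Fq n (s ^ q ^ j) := by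
  rw [kapT, RingHom.comp_apply, tauT_iota, tauT_C q hq]; rfl

theorem iotaT_injective : Function.Injective (iotaT Fq n) :=
  MvPolynomial.map_injective _ (IsFractionRing.injective _ _)

theorem kapT_injective : Function.Injective (kapT Fq n) :=
  iotaT_injective.comp (MvPolynomial.C_injective _ _)

/-- `P`-integral elements. -/
def IntAt (P : Fq[X]) (x : MvPolynomial (Fin n) (FractionRing Fq[X])) : Prop :=
  ∃ s y, ¬ P ∣ s ∧ kapT Fq n s * x = iotaT Fq n y

/-- `P` times `P`-integral elements. -/
def DivAt (P : Fq[X]) (x : MvPolynomial (Fin n) (FractionRing Fq[X])) : Prop :=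
  ∃ s y, ¬ P ∣ s ∧ kapT Fq n s * x = iotaT Fq n (MvPolynomial.C P * y)

theorem not_dvd_mul' {P s t : Fq[X]} (hP : Irreducible P) (hs : ¬ P ∣ s) (ht : ¬ P ∣ t) :
    ¬ P ∣ s * t := fun h => (hP.prime.dvd_or_dvd h).elim hs ht

theorem not_dvd_one' {P : Fq[X]} (hP : Irreducible P) : ¬ P ∣ 1 :=
  fun h => hP.not_isUnit (isUnit_of_dvd_one h)

variable {P : Fq[X]} {x x' : MvPolynomial (Fin n) (FractionRing Fq[X])}

theorem IntAt.iota (hP : Irreducible P) (y : MvPolynomial (Fin n) Fq[X]) : IntAt P (iotaT Fq n y) :=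
  ⟨1, y, not_dvd_one' hP, by simp⟩

theorem DivAt.iota (hP : Irreducible P) {y : MvPolynomial (Fin n) Fq[X]} (h : MvPolynomial.C P ∣ y) :
    DivAt P (iotaT Fq n y) := by
  obtain ⟨z, rfl⟩ := h
  exact ⟨1, z, not_dvd_one' hP, by simp⟩

theorem IntAt.add (hP : Irreducible P) (h : IntAt P x) (h' : IntAt P x') : IntAt P (x + x') := by
  obtain ⟨s, y, hs, h⟩ := h
  obtain ⟨s', y', hs', h'⟩ := h'
  refine ⟨s * s', MvPolynomial.C s' * y + MvPolynomial.C s * y', not_dvd_mul' hP hs hs', ?_⟩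
  rw [map_add, map_mul, map_mul, map_mul, ← h, ← h']
  simp only [kapT, RingHom.comp_apply]
  ring

theorem IntAt.mul (hP : Irreducible P) (h : IntAt P x) (h' : IntAt P x') : IntAt P (x * x') := by
  obtain ⟨s, y, hs, h⟩ := h
  obtain ⟨s', y', hs', h'⟩ := h'
  refine ⟨s * s', y * y', not_dvd_mul' hP hs hs', ?_⟩
  rw [map_mul, map_mul, ← h, ← h']
  ring

theorem IntAt.sum (hP : Irreducible P) {ι : Type*} (s : Finset ι) (f : ι → MvPolynomial (Fin n) (FractionRing Fq[X]))
    (h : ∀ i ∈ s, IntAt P (f i)) : IntAt P (∑ i ∈ s, f i) :=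
  Finset.sum_induction f _ (fun _ _ => IntAt.add hP) (by simpa using IntAt.iota hP (n := n) 0) h

theorem IntAt.tau (hP : Irreducible P) (j : ℕ) (h : IntAt P x) : IntAt P (tauT Fq (FractionRing Fq[X]) n j x) := by
  obtain ⟨s, y, hs, h⟩ := h
  refine ⟨s ^ (Fintype.card Fq) ^ j, tauT Fq _ n j y, fun hh => hs (hP.prime.dvd_of_dvd_pow hh), ?_⟩
  rw [← tauT_iota, ← h, map_mul, tauT_kap _ rfl]

theorem DivAt.add (hP : Irreducible P) (h : DivAt P x) (h' : DivAt P x') : DivAt P (x + x') := by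
  obtain ⟨s, y, hs, h⟩ := h
  obtain ⟨s', y', hs', h'⟩ := h'
  refine ⟨s * s', MvPolynomial.C s' * y + MvPolynomial.C s * y', not_dvd_mul' hP hs hs', ?_⟩
  simp only [kapT, RingHom.comp_apply, map_mul, map_add] at *
  linear_combination iotaT Fq n (MvPolynomial.C s') * h + iotaT Fq n (MvPolynomial.C s) * h'

theorem DivAt.mul (hP : Irreducible P) (h : DivAt P x) (h' : IntAt P x') : DivAt P (x * x') := by
  obtain ⟨s, y, hs, h⟩ := h
  obtain ⟨s', y', hs', h'⟩ := h'
  refine ⟨s * s', y * y', not_dvd_mul' hP hs hs', ?_⟩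
  rw [← mul_assoc (MvPolynomial.C P) y y', map_mul (iotaT Fq n) (_ * _) y', map_mul (kapT Fq n), ← h, ← h']
  ring

theorem DivAt.neg (hP : Irreducible P) (h : DivAt P x) : DivAt P (-x) := by
  have := DivAt.mul hP h (IntAt.iota hP (-1))
  have e : x * iotaT Fq n (-1) = -x := by
    rw [map_neg, map_one]; ring
  rwa [e] at this

theorem DivAt.sub (hP : Irreducible P) (h : DivAt P x) (h' : DivAt P x') : DivAt P (x - x') := by
  rw [sub_eq_add_neg]; exact DivAt.add hP h (DivAt.neg hP h')

theorem DivAt.sum (hP : Irreducible P) {ι : Type*} (s : Finset ι) (f : ι → MvPolynomial (Fin n) (FractionRing Fq[X]))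
    (h : ∀ i ∈ s, DivAt P (f i)) : DivAt P (∑ i ∈ s, f i) :=
  Finset.sum_induction f _ (fun _ _ => DivAt.add hP)
    (by simpa using DivAt.iota hP (n := n) (dvd_zero _)) h

theorem IntAt.of_mul (hP : Irreducible P) (h : DivAt P (kapT Fq n P * x)) : IntAt P x := by
  obtain ⟨s, y, hs, h⟩ := h
  refine ⟨s, y, hs, ?_⟩
  have h0 : kapT Fq n P ≠ 0 := by
    rw [← map_zero (kapT Fq n)]
    exact fun hh => hP.ne_zero (kapT_injective hh)
  apply mul_left_cancel₀ h0
  rw [mul_left_comm, h, map_mul]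
  rfl

theorem DivAt.tau_sub (hP : Irreducible P) (q : ℕ) (hq : q = Fintype.card Fq) (h : IntAt P x) :
    DivAt P (tauT Fq (FractionRing Fq[X]) n P.natDegree x - x) := by
  obtain ⟨s, y, hs, h⟩ := h
  have hy : MvPolynomial.C P ∣ tauT Fq _ n P.natDegree y - y := by
    rw [MvPolynomial.C_dvd_iff_dvd_coeff]
    intro m
    rw [MvPolynomial.coeff_sub, tauT, MvPolynomial.coeff_map]
    simp only [RingHom.coe_coe, frq_apply q hq]
    exact pow_frob_sub_dvd q hq hP _
  obtain ⟨z, hz⟩ := hy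
  obtain ⟨w, hw⟩ := pow_frob_sub_dvd q hq hP s
  refine ⟨s ^ q ^ P.natDegree * s, MvPolynomial.C s * z - MvPolynomial.C w * y, not_dvd_mul' hP (fun hh => hs (hP.prime.dvd_of_dvd_pow hh)) hs, ?_⟩
  have h2 := congrArg (tauT Fq (FractionRing Fq[X]) n P.natDegree) h
  rw [map_mul, tauT_kap q hq, tauT_iota] at h2
  have h3 := congrArg (iotaT Fq n) hz
  have h4 := congrArg (kapT Fq n) hw
  rw [map_mul, map_sub] at h3 h4
  rw [map_mul, map_mul, map_sub, map_mul, map_mul]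
  simp only [kapT, RingHom.comp_apply] at *
  linear_combination iotaT Fq n (MvPolynomial.C s) * h2 - iotaT Fq n (MvPolynomial.C (s ^ q ^ P.natDegree)) * h + iotaT Fq n (MvPolynomial.C s) * h3 - (iotaT Fq n y) * h4

end Integrality

/-- Being integral at every prime implies being integral. -/
theorem integral_of_IntAt {Fq : Type*} [Field Fq] [Fintype Fq] {n : ℕ}
    (x : MvPolynomial (Fin n) (FractionRing Fq[X]))
    (h : ∀ P : Fq[X], Irreducible P → P.Monic → IntAt P x) : ∃ y, x = iotaT Fq n y := by
  classical
  let I : Ideal Fq[X] :=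
    { carrier := {s | ∃ y, kapT Fq n s * x = iotaT Fq n y}
      add_mem' := by
        rintro a b ⟨y, hy⟩ ⟨z, hz⟩
        exact ⟨y + z, by rw [map_add, map_add, add_mul, hy, hz]⟩
      zero_mem' := ⟨0, by simp⟩
      smul_mem' := by
        rintro c a ⟨y, hy⟩
        refine ⟨MvPolynomial.C c * y, ?_⟩
        rw [smul_eq_mul, map_mul, mul_assoc, hy, map_mul]; rfl }
  have hI : I = ⊤ := by
    by_contra hne
    obtain ⟨M, hM, hle⟩ := Ideal.exists_le_maximal I hne
    have hMb : M ≠ ⊥ := Ring.ne_bot_of_isMaximal_of_not_isField hM (Polynomial.not_isField Fq)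
    obtain ⟨g, hg⟩ := (IsPrincipalIdealRing.principal M).principal
    have hg' : M = Ideal.span {g} := hg
    have hg0 : g ≠ 0 := by
      rintro rfl
      apply hMb
      rw [hg']; simp
    have hgp : Prime g := by
      rw [← Ideal.span_singleton_prime hg0, ← hg']
      exact hM.isPrime
    obtain ⟨s, y, hs, hsy⟩ := h (normalize g) ((associated_normalize g).irreducible hgp.irreducible)
      (Polynomial.monic_normalize hg0)
    apply hs
    have : s ∈ M := hle ⟨y, hsy⟩
    rw [hg', Ideal.mem_span_singleton] at this
    exact normalize_dvd_iff.2 this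
  have h1 : (1 : Fq[X]) ∈ I := hI ▸ Submodule.mem_top
  obtain ⟨y, hy⟩ := h1
  exact ⟨y, by rw [← hy, map_one, one_mul]⟩

open Finset.HasAntidiagonal in
theorem anti_triple {R : Type*} [AddCommMonoid R] (f : ℕ → ℕ → ℕ → R) (m : ℕ) :
    ∑ x ∈ antidiagonal m, ∑ y ∈ antidiagonal x.2, f x.1 y.1 y.2 =
    ∑ x ∈ antidiagonal m, ∑ y ∈ antidiagonal x.1, f y.1 y.2 x.2 := by
  rw [Finset.sum_sigma', Finset.sum_sigma']
  refine Finset.sum_bij' (fun z _ => ⟨(z.1.1 + z.2.1, z.2.2), (z.1.1, z.2.1)⟩)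
    (fun z _ => ⟨(z.2.1, z.2.2 + z.1.2), (z.2.2, z.1.2)⟩) ?_ ?_ ?_ ?_ ?_
  · rintro ⟨⟨a, b⟩, ⟨c, d⟩⟩ h
    rw [Finset.mem_sigma, mem_antidiagonal, mem_antidiagonal] at h ⊢
    dsimp only at h ⊢
    omega
  · rintro ⟨⟨a, b⟩, ⟨c, d⟩⟩ h
    rw [Finset.mem_sigma, mem_antidiagonal, mem_antidiagonal] at h ⊢
    dsimp only at h ⊢
    omega
  · rintro ⟨⟨a, b⟩, ⟨c, d⟩⟩ h
    simp only [Finset.mem_sigma, mem_antidiagonal] at h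
    obtain ⟨h1, rfl⟩ := h
    rfl
  · rintro ⟨⟨a, b⟩, ⟨c, d⟩⟩ h
    simp only [Finset.mem_sigma, mem_antidiagonal] at h
    obtain ⟨h1, rfl⟩ := h
    rfl
  · rintro ⟨⟨a, b⟩, ⟨c, d⟩⟩ h
    rfl

open Finset.HasAntidiagonal in
theorem anti_shift {R : Type*} [AddCommMonoid R] (f : ℕ → ℕ → R) (d m : ℕ) :
    ∑ x ∈ antidiagonal m, (if d ≤ x.2 then f x.1 (x.2 - d) else 0) =
    ∑ x ∈ antidiagonal m, (if x.1 = d then ∑ y ∈ antidiagonal x.2, f y.1 y.2 else 0) := by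
  have := anti_triple (fun a b c => if a = d then f b c else 0) m
  have e : ∀ x ∈ antidiagonal m, (if x.1 = d then ∑ y ∈ antidiagonal x.2, f y.1 y.2 else 0) =
     ∑ y ∈ antidiagonal x.2, (if x.1 = d then f y.1 y.2 else 0) := by
    intro x _
    split_ifs <;> simp
  rw [Finset.sum_congr rfl e]
  have h2 := anti_triple (fun b a c => if a = d then f b c else 0) m
  have h3 := anti_triple (fun a b c => if a = d then f b c else 0) m
  have e2 : ∀ x ∈ antidiagonal m, (if d ≤ x.2 then f x.1 (x.2 - d) else 0) =
     ∑ y ∈ antidiagonal x.2, (if y.1 = d then f x.1 y.2 else 0) := by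
    intro x _
    split_ifs with h
    · rw [Finset.sum_eq_single (d, x.2 - d)]
      · simp
      · rintro ⟨a, b⟩ hb hne
        rw [if_neg]
        rintro rfl
        simp only [mem_antidiagonal] at hb
        apply hne
        ext <;> simp; omega
      · intro hh
        exfalso; apply hh
        rw [mem_antidiagonal]; simp; omega
    · symm
      apply Finset.sum_eq_zero
      rintro ⟨a, b⟩ hb
      simp only [mem_antidiagonal] at hb
      rw [if_neg]
      simp; omega
  rw [Finset.sum_congr rfl e2, h2, h3]
  refine Finset.sum_congr rfl fun x _ => ?_
  rw [← Finset.Nat.sum_antidiagonal_swap]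
  rfl

open Finset.HasAntidiagonal in
theorem anti_carlitz {R : Type*} [CommRing R] (τ : ℕ → R →+* R)
    (hτ : ∀ i j x, τ i (τ j x) = τ (i + j) x) (B e p L : ℕ → R)
    (hB : ∀ i j, B i * τ i (B j) = B (i + j)) (m : ℕ) :
    ∑ x ∈ antidiagonal m, p x.1 * B x.1 * τ x.1 (∑ y ∈ antidiagonal x.2, e y.1 * B y.1 * τ y.1 (L y.2)) =
    ∑ x ∈ antidiagonal m, (∑ y ∈ antidiagonal x.1, p y.1 * τ y.1 (e y.2)) * B x.1 * τ x.1 (L x.2) := by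
  have h1 := anti_triple (fun a b c => p a * τ a (e b) * B (a + b) * τ (a + b) (L c)) m
  trans ∑ x ∈ antidiagonal m, ∑ y ∈ antidiagonal x.2,
    p x.1 * τ x.1 (e y.1) * B (x.1 + y.1) * τ (x.1 + y.1) (L y.2)
  · refine Finset.sum_congr rfl fun x _ => ?_
    rw [map_sum, Finset.mul_sum]
    refine Finset.sum_congr rfl fun y _ => ?_
    rw [map_mul, map_mul, hτ, ← hB]
    ring
  · rw [h1]
    refine Finset.sum_congr rfl fun x _ => ?_
    rw [Finset.sum_mul, Finset.sum_mul]
    refine Finset.sum_congr rfl fun y hy => ?_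
    rw [mem_antidiagonal] at hy
    rw [hy]

section Sets
variable {Fq : Type*} [Field Fq] [Fintype Fq]

open Classical in
/-- Polynomials of degree `< E`. -/
noncomputable def polyV (Fq : Type*) [Field Fq] [Fintype Fq] : ℕ → Finset Fq[X]
  | 0 => {0}
  | E + 1 => Finset.image (fun x : Fq[X] × Fq => x.1 + C x.2 * X ^ E) (polyV Fq E ×ˢ Finset.univ)

theorem mem_polyV (E : ℕ) (a : Fq[X]) : a ∈ polyV Fq E ↔ a.degree < E := by
  induction E generalizing a with
  | zero => simp [polyV, Polynomial.degree_lt_iff_coeff_zero, Polynomial.ext_iff]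
  | succ E ih =>
    simp only [polyV, Finset.mem_image, Finset.mem_product, Finset.mem_univ, and_true, Prod.exists, ih]
    constructor
    · rintro ⟨b, c, hb, rfl⟩
      rw [Polynomial.degree_lt_iff_coeff_zero] at hb ⊢
      intro m hm
      rw [coeff_add, hb m (by omega), coeff_C_mul, coeff_X_pow, if_neg (by omega)]
      simp
    · intro h
      refine ⟨a - C (a.coeff E) * X ^ E, a.coeff E, ?_, by ring⟩
      rw [Polynomial.degree_lt_iff_coeff_zero] at h ⊢
      intro m hm
      rw [coeff_sub, coeff_C_mul, coeff_X_pow]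
      split_ifs with hh
      · subst hh; simp
      · rw [h m (by omega)]; simp

open Classical in
/-- Monic polynomials of degree `e`. -/
noncomputable def polyM (Fq : Type*) [Field Fq] [Fintype Fq] (e : ℕ) : Finset Fq[X] :=
  Finset.image (fun x : Fq[X] => x + X ^ e) (polyV Fq e)

theorem mem_polyM (e : ℕ) (a : Fq[X]) : a ∈ polyM Fq e ↔ a.Monic ∧ a.natDegree = e := by
  simp only [polyM, Finset.mem_image, mem_polyV]
  constructor
  · rintro ⟨b, hb, rfl⟩
    have h1 : (b + X ^ e).Monic := by
      rw [add_comm]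
      exact Polynomial.monic_X_pow_add hb
    refine ⟨h1, ?_⟩
    rw [Polynomial.natDegree_add_eq_right_of_degree_lt]
    · simp
    · simpa using hb
  · rintro ⟨hm, rfl⟩
    refine ⟨a - X ^ a.natDegree, ?_, by ring⟩
    have := Polynomial.degree_sub_lt_left (p := a) (q := X ^ a.natDegree) (by
      rw [Polynomial.degree_eq_natDegree hm.ne_zero]; simp) hm.ne_zero (by simp [hm.leadingCoeff])
    rwa [Polynomial.degree_eq_natDegree hm.ne_zero] at this

theorem polyM_split (P : Fq[X]) (hP : P.Monic) {R : Type*} [AddCommMonoid R] (f : Fq[X] → R) (e : ℕ) :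
    letI := Classical.decPred (fun a : Fq[X] => P ∣ a)
    ∑ a ∈ polyM Fq e, f a = ∑ a ∈ (polyM Fq e).filter (fun a => ¬ P ∣ a), f a +
      (if P.natDegree ≤ e then ∑ a ∈ polyM Fq (e - P.natDegree), f (P * a) else 0) := by
  classical
  rw [← Finset.sum_filter_not_add_sum_filter _ (fun a : Fq[X] => P ∣ a)]
  congr 1
  split_ifs with h
  · symm
    refine Finset.sum_bij (fun a _ => P * a) ?_ ?_ ?_ ?_
    · intro a ha
      rw [mem_polyM] at ha
      rw [Finset.mem_filter, mem_polyM]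
      refine ⟨⟨hP.mul ha.1, ?_⟩, dvd_mul_right _ _⟩
      rw [hP.natDegree_mul ha.1, ha.2]; omega
    · intro a _ b _ hab
      exact mul_left_cancel₀ hP.ne_zero hab
    · intro b hb
      rw [Finset.mem_filter, mem_polyM] at hb
      obtain ⟨⟨hb1, hb2⟩, a, rfl⟩ := hb
      have ha : a.Monic := hP.of_mul_monic_left hb1
      refine ⟨a, ?_, rfl⟩
      rw [mem_polyM]
      refine ⟨ha, ?_⟩
      rw [hP.natDegree_mul ha] at hb2; omega
    · intros; rfl
  · apply Finset.sum_eq_zero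
    intro a ha
    rw [Finset.mem_filter, mem_polyM] at ha
    obtain ⟨⟨hb1, hb2⟩, b, rfl⟩ := ha
    rw [hP.natDegree_mul (hP.of_mul_monic_left hb1)] at hb2; omega

end Sets

/-- `b_j(t₁)⋯b_j(t_n)` -/
noncomputable def BT (Fq : Type*) [Field Fq] (n q j : ℕ) : MvPolynomial (Fin n) Fq[X] :=
  ∏ i : Fin n, ∏ k ∈ Finset.range j, (MvPolynomial.X i - MvPolynomial.C (X ^ q ^ k))

/-- `a(t₁)⋯a(t_n)` -/
noncomputable def chiT (Fq : Type*) [Field Fq] (n : ℕ) (a : Fq[X]) : MvPolynomial (Fin n) Fq[X] :=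
  ∏ i : Fin n, aeval (MvPolynomial.X i) a

/-- degree `e` part of the `L`-series. -/
noncomputable def LsT (Fq : Type*) [Field Fq] [Fintype Fq] (n e : ℕ) :
    MvPolynomial (Fin n) (FractionRing Fq[X]) :=
  ∑ a ∈ polyM Fq e, MvPolynomial.C (algebraMap Fq[X] (FractionRing Fq[X]) a)⁻¹ * iotaT Fq n (chiT Fq n a)

/-- degree `m` part of `exp(L)`. -/
noncomputable def uT (Fq : Type*) [Field Fq] [Fintype Fq] (n q : ℕ) (D : ℕ → Fq[X]) (m : ℕ) :
    MvPolynomial (Fin n) (FractionRing Fq[X]) :=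
  ∑ x ∈ Finset.HasAntidiagonal.antidiagonal m,
    MvPolynomial.C (algebraMap Fq[X] (FractionRing Fq[X]) (D x.1))⁻¹ * iotaT Fq n (BT Fq n q x.1) *
      tauT Fq (FractionRing Fq[X]) n x.1 (LsT Fq n x.2)

section
variable {Fq : Type*} [Field Fq] [Fintype Fq] {n : ℕ}

theorem tau_BT (q : ℕ) (hq : q = Fintype.card Fq) (i j : ℕ) :
    BT Fq n q i * tauT Fq Fq[X] n i (BT Fq n q j) = BT Fq n q (i + j) := by
  rw [BT, BT, BT, map_prod, ← Finset.prod_mul_distrib]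
  refine Finset.prod_congr rfl fun l _ => ?_
  rw [map_prod, Finset.prod_range_add]
  congr 1
  refine Finset.prod_congr rfl fun k _ => ?_
  rw [map_sub, tauT_X, tauT_C q hq, ← pow_mul, ← pow_add, add_comm k i]

theorem chiT_mul (a b : Fq[X]) : chiT Fq n (a * b) = chiT Fq n a * chiT Fq n b := by
  simp [chiT, Finset.prod_mul_distrib]

theorem tau_chiT (j : ℕ) (a : Fq[X]) : tauT Fq Fq[X] n j (chiT Fq n a) = chiT Fq n a := by
  rw [chiT, map_prod]
  refine Finset.prod_congr rfl fun i _ => ?_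
  induction a using Polynomial.induction_on' with
  | add p q hp hq => rw [map_add, map_add, hp, hq]
  | monomial k c =>
    rw [aeval_monomial, map_mul, map_pow, tauT_X]
    congr 1
    rw [IsScalarTower.algebraMap_apply Fq Fq[X] (MvPolynomial (Fin n) Fq[X])]
    rw [MvPolynomial.algebraMap_eq, tauT_C _ rfl, Polynomial.algebraMap_eq, C_pow_q _ rfl]

theorem C_inv_kap {a : Fq[X]} (ha : a ≠ 0) :
    MvPolynomial.C (algebraMap Fq[X] (FractionRing Fq[X]) a)⁻¹ * kapT Fq n a = 1 := by
  rw [kapT, RingHom.comp_apply, iotaT, MvPolynomial.map_C, ← MvPolynomial.C_mul, inv_mul_cancel₀, MvPolynomial.C_1]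
  exact (map_ne_zero_iff _ (IsFractionRing.injective _ _)).2 ha

theorem C_algebraMap_eq_kap (a : Fq[X]) :
    MvPolynomial.C (algebraMap Fq[X] (FractionRing Fq[X]) a) = kapT Fq n a := by
  rw [kapT, RingHom.comp_apply, iotaT, MvPolynomial.map_C]

theorem D_ne_zero (q : ℕ) (hq : q = Fintype.card Fq) (D : ℕ → Fq[X]) (hD0 : D 0 = 1)
    (hD : ∀ i : ℕ, D (i + 1) = (X ^ q ^ (i + 1) - X) * (D i) ^ q) (k : ℕ) : D k ≠ 0 := by
  have hq1 : 1 < q := hq ▸ Fintype.one_lt_card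
  induction k with
  | zero => simp [hD0]
  | succ k ih =>
    rw [hD]
    refine mul_ne_zero ?_ (pow_ne_zero _ ih)
    exact FiniteField.X_pow_card_sub_X_ne_zero _ (Nat.one_lt_pow (by omega) hq1)

theorem IntAt.C_inv {P : Fq[X]} {a : Fq[X]} (ha : ¬ P ∣ a) :
    IntAt (n := n) P (MvPolynomial.C (algebraMap Fq[X] (FractionRing Fq[X]) a)⁻¹) := by
  refine ⟨a, 1, ha, ?_⟩
  rw [mul_comm, C_inv_kap, map_one]
  rintro rfl
  exact ha (dvd_zero _)

theorem DivAt.D_inv (q : ℕ) (hq : q = Fintype.card Fq) (D : ℕ → Fq[X]) (hD0 : D 0 = 1)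
    (hD : ∀ i : ℕ, D (i + 1) = (X ^ q ^ (i + 1) - X) * (D i) ^ q)
    {P : Fq[X]} (hP : Irreducible P) (k : ℕ) :
    DivAt (n := n) P (kapT Fq n (P ^ q ^ k) *
      MvPolynomial.C (algebraMap Fq[X] (FractionRing Fq[X]) (D k))⁻¹) := by
  obtain ⟨e, s, he, hs, hDk⟩ := D_factor q hq hP D hD0 hD k
  obtain ⟨r, hr⟩ := Nat.exists_eq_add_of_le he
  refine ⟨s, MvPolynomial.C (P ^ r), hs, ?_⟩
  have h1 := C_inv_kap (n := n) (D_ne_zero q hq D hD0 hD k)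
  have h0 : kapT Fq n (P ^ e) ≠ 0 := by
    rw [← map_zero (kapT Fq n)]
    exact fun hh => pow_ne_zero _ hP.ne_zero (kapT_injective hh)
  rw [hDk, map_mul (kapT Fq n)] at h1
  rw [hDk, hr, map_mul (iotaT Fq n)]
  have : iotaT Fq n (MvPolynomial.C P) * iotaT Fq n (MvPolynomial.C (P^r)) = kapT Fq n (P * P ^ r) := by
    rw [map_mul]; rfl
  rw [this, pow_add, pow_succ, mul_assoc, map_mul (kapT Fq n) (P ^ e)]
  linear_combination kapT Fq n (P * P ^ r) * h1

theorem p_dvd (q : ℕ) (hq : q = Fintype.card Fq) {P : Fq[X]} (hP : Irreducible P) (p : ℕ → Fq[X])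
    (h0 : p 0 = P) (hp : ∀ k, (X ^ q ^ (k + 1) - X) * p (k + 1) = p k ^ q - p k) (k : ℕ)
    (hk : k < P.natDegree) : P ∣ p k := by
  have hq1 : 1 < q := hq ▸ Fintype.one_lt_card
  induction k with
  | zero => rw [h0]
  | succ k ih =>
    have h1 := ih (by omega)
    have h2 : P ∣ p k ^ q - p k := dvd_sub (dvd_pow h1 (by omega)) h1
    rw [← hp] at h2
    exact (hP.prime.dvd_or_dvd h2).resolve_left (bracket_not_dvd q hq hP (by omega) hk)

theorem BT_sub_chi (q : ℕ) (hq : q = Fintype.card Fq) {P : Fq[X]} (hP : Irreducible P) (hPm : P.Monic) (p : ℕ → Fq[X])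
    (h0 : p 0 = P) (hd : p P.natDegree = 1)
    (hp : ∀ k, (X ^ q ^ (k + 1) - X) * p (k + 1) = p k ^ q - p k)
    (ht : ∀ i : Fin n, aeval (MvPolynomial.X i : MvPolynomial (Fin n) Fq[X]) P =
        ∑ k ∈ Finset.range (P.natDegree + 1), MvPolynomial.C (p k) *
          ∏ l ∈ Finset.range k, (MvPolynomial.X i - MvPolynomial.C (X ^ q ^ l))) :
    MvPolynomial.C P ∣ BT Fq n q P.natDegree - chiT Fq n P := by
  rw [← Ideal.mem_span_singleton, ← Ideal.Quotient.eq, BT, chiT, map_prod, map_prod]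
  refine Finset.prod_congr rfl fun i _ => ?_
  rw [ht, Ideal.Quotient.eq, Finset.sum_range_succ, hd, map_one, one_mul, sub_add_cancel_right,
    neg_mem_iff, Ideal.mem_span_singleton]
  refine Finset.dvd_sum fun k hk => ?_
  refine Dvd.dvd.mul_right ?_ _
  exact map_dvd _ (p_dvd q hq hP p h0 hp k (Finset.mem_range.1 hk))

open Classical in
theorem LT_split {P : Fq[X]} (hP : Irreducible P) (hPm : P.Monic) (e : ℕ) :
    ∃ L' : MvPolynomial (Fin n) (FractionRing Fq[X]), IntAt P L' ∧
      LsT Fq n e = L' + if P.natDegree ≤ e then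
        MvPolynomial.C (algebraMap Fq[X] (FractionRing Fq[X]) P)⁻¹ * iotaT Fq n (chiT Fq n P) * LsT Fq n (e - P.natDegree) else 0 := by
  refine ⟨∑ a ∈ (polyM Fq e).filter (fun a => ¬ P ∣ a),
    MvPolynomial.C (algebraMap Fq[X] (FractionRing Fq[X]) a)⁻¹ * iotaT Fq n (chiT Fq n a), ?_, ?_⟩
  rotate_left
  · rw [LsT, polyM_split P hPm]
    congr 1
    refine if_congr Iff.rfl ?_ rfl
    rw [LsT, Finset.mul_sum]
    refine Finset.sum_congr rfl fun a _ => ?_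
    rw [chiT_mul, map_mul, mul_inv, map_mul, map_mul]
    ring
  · refine IntAt.sum hP _ _ fun a ha => ?_
    rw [Finset.mem_filter] at ha
    exact IntAt.mul hP (IntAt.C_inv ha.2) (IntAt.iota hP _)

open Finset.HasAntidiagonal in
theorem uT_int (q : ℕ) (hq : q = Fintype.card Fq) (D : ℕ → Fq[X]) (hD0 : D 0 = 1)
    (hD : ∀ i : ℕ, D (i + 1) = (X ^ q ^ (i + 1) - X) * (D i) ^ q)
    {P : Fq[X]} (hP : Irreducible P) (hPm : P.Monic) (m : ℕ) : IntAt P (uT Fq n q D m) := by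
  classical
  have hq1 : 1 < q := hq ▸ Fintype.one_lt_card
  have hDne := D_ne_zero q hq D hD0 hD
  induction m using Nat.strong_induction_on with
  | _ m ih =>
  have inj := IsFractionRing.injective Fq[X] (FractionRing Fq[X])
  obtain ⟨p, p0, pd, pgt, prec, paev, pexp⟩ := carlitz_exists q hq n
    (fun j => (algebraMap Fq[X] (FractionRing Fq[X]) (D j))⁻¹) (by simp [hD0]) (by
      intro j
      have h1 : algebraMap Fq[X] (FractionRing Fq[X]) (D j) ≠ 0 := (map_ne_zero_iff _ inj).2 (hDne _)
      have h2 : algebraMap Fq[X] (FractionRing Fq[X]) (D (j+1)) ≠ 0 := (map_ne_zero_iff _ inj).2 (hDne _)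
      have h3 := congrArg (algebraMap Fq[X] (FractionRing Fq[X])) (hD j)
      rw [map_mul, map_pow] at h3
      have h4 : algebraMap Fq[X] (FractionRing Fq[X]) (X ^ q ^ (j + 1) - X) ≠ 0 := by
        intro h; rw [h, zero_mul] at h3; exact h2 h3
      rw [h3, mul_inv, mul_inv_cancel_left₀ h4, inv_pow]) P.natDegree P le_rfl
  have pd' : p P.natDegree = 1 := by rw [pd, hPm.coeff_natDegree, map_one]
  have hdpos : 0 < P.natDegree := hP.natDegree_pos
  set τ := tauT Fq (FractionRing Fq[X]) n with hτ
  set B : ℕ → MvPolynomial (Fin n) (FractionRing Fq[X]) := fun j => iotaT Fq n (BT Fq n q j) with hB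
  set ee : ℕ → MvPolynomial (Fin n) (FractionRing Fq[X]) := fun j =>
    MvPolynomial.C (algebraMap Fq[X] (FractionRing Fq[X]) (D j))⁻¹ with hee
  have hu : ∀ l, uT Fq n q D l = ∑ y ∈ antidiagonal l, ee y.1 * B y.1 * τ y.1 (LsT Fq n y.2) := fun l => rfl
  have key := anti_carlitz τ (fun i j x => tauT_tauT i j x) B ee (fun k => kapT Fq n (p k)) (LsT Fq n) (by
    intro i j
    simp only [hB, hτ]
    rw [tauT_iota, ← map_mul, tau_BT q hq]) m
  simp only [← hu] at key
  have hpe : ∀ k, ∑ y ∈ antidiagonal k, kapT Fq n (p y.1) * τ y.1 (ee y.2) = kapT Fq n (P ^ q ^ k) * ee k := by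
    intro k
    have h1 := congrArg (MvPolynomial.C (σ := Fin n)) (pexp k)
    rw [map_sum, map_mul, C_algebraMap_eq_kap] at h1
    rw [← h1]
    refine Finset.sum_congr rfl fun y _ => ?_
    rw [hτ, hee, tauT_C q hq, map_mul, C_algebraMap_eq_kap]
  simp only [hpe] at key
  choose L' hL' hLs using fun e => LT_split (n := n) hP hPm e
  have hR : ∑ x ∈ antidiagonal m, kapT Fq n (P ^ q ^ x.1) * ee x.1 * B x.1 * τ x.1 (LsT Fq n x.2) =
      ∑ x ∈ antidiagonal m, kapT Fq n (P ^ q ^ x.1) * ee x.1 * B x.1 * τ x.1 (L' x.2) +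
      ∑ x ∈ antidiagonal m, (if x.1 = P.natDegree then iotaT Fq n (chiT Fq n P) * uT Fq n q D x.2 else 0) := by
    have h1 := anti_shift (fun k e => iotaT Fq n (chiT Fq n P) * (ee k * B k * τ k (LsT Fq n e))) P.natDegree m
    simp only [← Finset.mul_sum, ← hu] at h1
    rw [← h1, ← Finset.sum_add_distrib]
    refine Finset.sum_congr rfl fun x _ => ?_
    rw [hLs x.2, map_add, mul_add]
    congr 1
    split_ifs with h
    · rw [map_mul, map_mul, hτ, tauT_C q hq, tauT_iota, tau_chiT]
      have h2 := C_inv_kap (n := n) (pow_ne_zero (q ^ x.1) hP.ne_zero)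
      rw [map_pow (algebraMap _ _), ← inv_pow] at h2
      linear_combination (iotaT Fq n (chiT Fq n P) * (ee x.1 * B x.1 * tauT Fq (FractionRing Fq[X]) n x.1 (LsT Fq n (x.2 - P.natDegree)))) * h2
    · simp
  have hR1 : DivAt P (∑ x ∈ antidiagonal m, kapT Fq n (P ^ q ^ x.1) * ee x.1 * B x.1 * τ x.1 (L' x.2)) := by
    refine DivAt.sum hP _ _ fun x _ => ?_
    rw [mul_assoc]
    refine DivAt.mul hP (DivAt.D_inv q hq D hD0 hD hP x.1) (IntAt.mul hP (IntAt.iota hP _) (IntAt.tau hP _ (hL' _)))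
  have hLL : DivAt P (∑ x ∈ antidiagonal m, (kapT Fq n (p x.1) * B x.1 * τ x.1 (uT Fq n q D x.2) -
      (if x.1 = 0 then kapT Fq n P * uT Fq n q D m else 0) -
      (if x.1 = P.natDegree then iotaT Fq n (chiT Fq n P) * uT Fq n q D x.2 else 0))) := by
    refine DivAt.sum hP _ _ ?_
    rintro ⟨i, l⟩ hx
    rw [mem_antidiagonal] at hx
    dsimp only at hx ⊢
    rcases Nat.eq_zero_or_pos i with rfl | hi
    · have hl : l = m := by omega
      subst hl
      rw [if_pos rfl, if_neg (by omega), p0, hB, hτ, tauT_zero]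
      have : BT Fq n q 0 = 1 := by simp [BT]
      simp only [this, map_one, mul_one, sub_self]
      simpa using DivAt.iota hP (n := n) (dvd_zero _)
    · have hul := ih l (by omega)
      rw [if_neg (by omega), sub_zero]
      rcases lt_trichotomy i P.natDegree with h | h | h
      · rw [if_neg (by omega), sub_zero, mul_assoc]
        refine DivAt.mul hP ?_ (IntAt.mul hP (IntAt.iota hP _) (IntAt.tau hP _ hul))
        exact DivAt.iota hP (map_dvd _ (p_dvd q hq hP p p0 prec i h))
      · subst h
        rw [if_pos rfl, pd', map_one, one_mul]
        have e : B P.natDegree * τ P.natDegree (uT Fq n q D l) - iotaT Fq n (chiT Fq n P) * uT Fq n q D l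
          = iotaT Fq n (BT Fq n q P.natDegree - chiT Fq n P) * τ P.natDegree (uT Fq n q D l)
            + (τ P.natDegree (uT Fq n q D l) - uT Fq n q D l) * iotaT Fq n (chiT Fq n P) := by
          rw [map_sub]; ring
        rw [e]
        exact DivAt.add hP (DivAt.mul hP (DivAt.iota hP (BT_sub_chi q hq hP hPm p p0 pd' prec paev)) (IntAt.tau hP _ hul))
          (DivAt.mul hP (DivAt.tau_sub hP q hq hul) (IntAt.iota hP _))
      · rw [if_neg (by omega), pgt i h]
        simpa using DivAt.iota hP (n := n) (dvd_zero _)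
  apply IntAt.of_mul hP
  have hz : ∑ x ∈ antidiagonal m, (if x.1 = 0 then kapT Fq n P * uT Fq n q D m else 0) = kapT Fq n P * uT Fq n q D m := by
    rw [Finset.sum_eq_single (0, m)]
    · simp
    · rintro ⟨i, l⟩ hx hne
      rw [mem_antidiagonal] at hx
      dsimp only at hx ⊢
      rw [if_neg]
      rintro rfl
      apply hne
      ext <;> simp; omega
    · intro h; exfalso; apply h; rw [mem_antidiagonal]; simp
  rw [Finset.sum_sub_distrib, Finset.sum_sub_distrib, hz, key, hR] at hLL
  have := DivAt.sub hP hR1 hLL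
  convert this using 1
  ring

theorem uT_integral (q : ℕ) (hq : q = Fintype.card Fq) (D : ℕ → Fq[X]) (hD0 : D 0 = 1)
    (hD : ∀ i : ℕ, D (i + 1) = (X ^ q ^ (i + 1) - X) * (D i) ^ q) (m : ℕ) :
    ∃ y, uT Fq n q D m = iotaT Fq n y :=
  integral_of_IntAt _ fun _ hP hPm => uT_int q hq D hD0 hD hP hPm m

theorem tau_LT (q : ℕ) (hq : q = Fintype.card Fq) (j e : ℕ) :
    tauT Fq (FractionRing Fq[X]) n j (LsT Fq n e) = ∑ a ∈ polyM Fq e,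
      MvPolynomial.C ((algebraMap Fq[X] (FractionRing Fq[X]) a)⁻¹ ^ q ^ j) * iotaT Fq n (chiT Fq n a) := by
  rw [LsT, map_sum]
  refine Finset.sum_congr rfl fun a _ => ?_
  rw [map_mul, tauT_C q hq, tauT_iota, tau_chiT]
end

section
variable {Fq : Type*} [Field Fq] [Fintype Fq]

theorem sum_polyV_succ {R : Type*} [AddCommMonoid R] (f : Fq[X] → R) (E : ℕ) :
    ∑ a ∈ polyV Fq (E + 1), f a = ∑ a ∈ polyV Fq E, ∑ c : Fq, f (a + C c * X ^ E) := by
  classical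
  rw [polyV, Finset.sum_image, Finset.sum_product]
  rintro ⟨a, c⟩ h ⟨a', c'⟩ h' hh
  simp only [Finset.coe_product, Finset.coe_univ, Set.mem_prod, Finset.mem_coe, mem_polyV, Set.mem_univ, and_true] at h h'
  dsimp only at hh
  have h1 := congrArg (fun p => coeff p E) hh
  simp only [coeff_add, coeff_C_mul, coeff_X_pow, if_pos, mul_one,
    (Polynomial.degree_lt_iff_coeff_zero _ _).1 h E le_rfl,
    (Polynomial.degree_lt_iff_coeff_zero _ _).1 h' E le_rfl, zero_add] at h1
  subst h1
  simpa using hh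

theorem card_eq_zero' {R : Type*} [CommRing R] [Algebra Fq R] : ((Fintype.card Fq : ℕ) : R) = 0 := by
  rw [← map_natCast (algebraMap Fq R), FiniteField.cast_card_eq_zero, map_zero]

theorem sum_polyV_eval (E : ℕ) (f : Fq[X][X]) (hf : f.degree < E) :
    ∑ a ∈ polyV Fq E, f.eval a = 0 := by
  induction E generalizing f with
  | zero =>
    have : f = 0 := by simpa using hf
    simp [this]
  | succ E ih =>
    rw [sum_polyV_succ]
    have := ih (∑ c : Fq, taylor (C c * X ^ E) f) (by
      rw [degree_lt_iff_coeff_zero] at hf ⊢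
      have hn : f.natDegree ≤ E := by
        rw [natDegree_le_iff_coeff_eq_zero]
        intro m hm
        exact hf m (by omega)
      intro m hm
      rw [finsetSum_coeff]
      have : ∀ c : Fq, (taylor (C c * X ^ E) f).coeff m = f.coeff m := by
        intro c
        rcases (Nat.lt_or_ge f.natDegree m) with h | h
        · rw [coeff_eq_zero_of_natDegree_lt h, coeff_eq_zero_of_natDegree_lt (by rwa [natDegree_taylor])]
        · have : m = f.natDegree := by omega
          rw [this, coeff_taylor_natDegree]; rfl
      simp only [this]
      rw [Finset.sum_const, Finset.card_univ, nsmul_eq_mul, card_eq_zero' (Fq := Fq), zero_mul])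
    rw [← this]
    refine Finset.sum_congr rfl fun a _ => ?_
    rw [eval_finsetSum]
    refine Finset.sum_congr rfl fun c _ => ?_
    rw [taylor_eval, add_comm]

theorem sum_polyV_pow (q : ℕ) (hq : q = Fintype.card Fq) (N : ℕ) (hN : 0 < N) (hd : (q - 1) ∣ N) (E : ℕ) :
    ∑ a ∈ polyV Fq E, a ^ N = - ∑ e ∈ Finset.range E, ∑ a ∈ polyM Fq e, a ^ N := by
  classical
  induction E with
  | zero => simp [polyV, hN.ne']
  | succ E ih =>
    rw [sum_polyV_succ, Finset.sum_range_succ, neg_add, ← ih, Finset.sum_comm,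
      ← Finset.add_sum_erase _ _ (Finset.mem_univ (0 : Fq))]
    congr 1
    · simp
    · have hM : ∑ a ∈ polyM Fq E, a ^ N = ∑ a ∈ polyV Fq E, (a + X ^ E) ^ N := by
        rw [polyM, Finset.sum_image]
        intro a _ b _ h
        simpa using h
      have : ∀ c ∈ Finset.univ.erase (0 : Fq), ∑ a ∈ polyV Fq E, (a + C c * X ^ E) ^ N = ∑ a ∈ polyM Fq E, a ^ N := by
        intro c hc
        have hc0 : c ≠ 0 := Finset.ne_of_mem_erase hc
        have hcN : c ^ N = 1 := by
          obtain ⟨r, rfl⟩ := hd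
          rw [pow_mul, hq, FiniteField.pow_card_sub_one_eq_one c hc0, one_pow]
        rw [hM]
        symm
        refine Finset.sum_bij (fun a _ => C c * a) ?_ ?_ ?_ ?_
        · intro a ha
          rw [mem_polyV] at ha ⊢
          rwa [degree_C_mul hc0]
        · intro a _ b _ hab
          exact mul_left_cancel₀ (by simpa using hc0) hab
        · intro b hb
          rw [mem_polyV] at hb
          refine ⟨C c⁻¹ * b, ?_, ?_⟩
          · rw [mem_polyV, degree_C_mul (inv_ne_zero hc0)]; exact hb
          · rw [← mul_assoc, ← C_mul, mul_inv_cancel₀ hc0, C_1, one_mul]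
        · intro a _
          rw [← mul_add, mul_pow, ← C_pow, hcN, C_1, one_mul]
      rw [Finset.sum_congr rfl this, Finset.sum_const, Finset.card_erase_of_mem (Finset.mem_univ _),
        Finset.card_univ, nsmul_eq_mul, Nat.cast_sub Fintype.card_pos, card_eq_zero' (Fq := Fq)]
      simp

theorem trivial_zero (q : ℕ) (hq : q = Fintype.card Fq) (N : ℕ) (hN : 0 < N) (hd : (q - 1) ∣ N) (E : ℕ)
    (hE : N < E) : ∑ e ∈ Finset.range E, ∑ a ∈ polyM Fq e, a ^ N = 0 := by
  have h := sum_polyV_pow q hq N hN hd E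
  have h2 := sum_polyV_eval E (X ^ N : Fq[X][X]) (by rw [degree_X_pow]; exact_mod_cast hE)
  simp only [eval_pow, eval_X] at h2
  rw [h2] at h
  simpa using h.symm

variable {n : ℕ}

theorem eval_iota (x : Fin n → Fq[X]) (y : MvPolynomial (Fin n) Fq[X]) :
    MvPolynomial.eval (fun i => algebraMap Fq[X] (FractionRing Fq[X]) (x i)) (iotaT Fq n y) =
      algebraMap Fq[X] (FractionRing Fq[X]) (MvPolynomial.eval x y) := by
  rw [iotaT, MvPolynomial.eval_map]
  exact (MvPolynomial.eval₂_comp_left (algebraMap Fq[X] (FractionRing Fq[X])) (RingHom.id _) x y).symm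

theorem eval_chi (q : ℕ) (hq : q = Fintype.card Fq) (k : Fin n → ℕ) (a : Fq[X]) :
    MvPolynomial.eval (fun i => (X : Fq[X]) ^ q ^ k i) (chiT Fq n a) = a ^ ∑ i, q ^ k i := by
  rw [chiT, map_prod, ← Finset.prod_pow_eq_pow_sum]
  refine Finset.prod_congr rfl fun i _ => ?_
  have h1 : ∀ b : Fq[X], MvPolynomial.eval (fun i => (X : Fq[X]) ^ q ^ k i) (aeval (MvPolynomial.X i) b) =
      aeval ((X : Fq[X]) ^ q ^ k i) b := by
    intro b
    induction b using Polynomial.induction_on' with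
    | add p q hp hq => simp only [map_add, hp, hq]
    | monomial m c =>
      rw [aeval_monomial, aeval_monomial, map_mul, map_pow, MvPolynomial.eval_X]
      congr 1
      rw [IsScalarTower.algebraMap_apply Fq Fq[X] (MvPolynomial (Fin n) Fq[X]), MvPolynomial.algebraMap_eq,
        MvPolynomial.eval_C]
  rw [h1, ← frq_apply q hq, ← frq_apply q hq, aeval_algHom_apply, aeval_X_left_apply]

theorem exists_M_eval (q : ℕ) (hq : q = Fintype.card Fq) (hn : q ≤ n) (hn1 : n % (q - 1) = 1 % (q - 1))
    (D : ℕ → Fq[X]) (k : Fin n → ℕ) (M : ℕ) (hM : ∑ i, q ^ k i ≤ M) :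
    MvPolynomial.eval (fun i => algebraMap Fq[X] (FractionRing Fq[X]) (X ^ q ^ k i))
      (∑ m ∈ Finset.range (M + 1), uT Fq n q D m) = 0 := by
  have hq1 : 1 < q := hq ▸ Fintype.one_lt_card
  have inj := IsFractionRing.injective Fq[X] (FractionRing Fq[X])
  simp only [uT]
  simp only [Finset.Nat.sum_antidiagonal_eq_sum_range_succ_mk]
  rw [Finset.sum_range_diag_flip (M + 1) (fun j e => MvPolynomial.C (algebraMap Fq[X] (FractionRing Fq[X]) (D j))⁻¹ * iotaT Fq n (BT Fq n q j) *
      tauT Fq (FractionRing Fq[X]) n j (LsT Fq n e)), map_sum]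
  refine Finset.sum_eq_zero fun j _ => ?_
  rw [← Finset.mul_sum, map_mul, map_mul]
  by_cases hj : ∃ i, k i < j
  · obtain ⟨i, hi⟩ := hj
    have : MvPolynomial.eval (fun i => algebraMap Fq[X] (FractionRing Fq[X]) (X ^ q ^ k i)) (iotaT Fq n (BT Fq n q j)) = 0 := by
      rw [eval_iota, BT, map_prod, Finset.prod_eq_zero (Finset.mem_univ i), map_zero]
      rw [map_prod, Finset.prod_eq_zero (Finset.mem_range.2 hi)]
      simp
    rw [this]; ring
  · push Not at hj
    have hS : n * q ^ j ≤ ∑ i, q ^ k i := by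
      calc n * q ^ j = ∑ i : Fin n, q ^ j := by simp
        _ ≤ _ := Finset.sum_le_sum fun i _ => Nat.pow_le_pow_right (by omega) (hj i)
    have hpos : 0 < q ^ j := by positivity
    have hlt : q ^ j < ∑ i, q ^ k i := by nlinarith
    have hjq : j < q ^ j := Nat.lt_pow_self hq1
    obtain ⟨N, hN⟩ := Nat.exists_eq_add_of_lt hlt
    have hdvd : (q - 1) ∣ N + 1 := by
      have hone : ∀ l, q ^ l ≡ 1 [MOD (q - 1)] := by
        intro l
        have : q ≡ 1 [MOD (q - 1)] := ((Nat.modEq_iff_dvd' (by omega)).2 dvd_rfl).symm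
        simpa using this.pow l
      have h1 : ∑ i, q ^ k i ≡ n [MOD (q - 1)] := by
        have : ∑ i, q ^ k i ≡ ∑ i : Fin n, 1 [MOD (q - 1)] := by
          refine (ZMod.natCast_eq_natCast_iff _ _ _).1 ?_
          rw [Nat.cast_sum, Nat.cast_sum]
          exact Finset.sum_congr rfl fun i _ => (ZMod.natCast_eq_natCast_iff _ _ _).2 (hone _)
        simpa using this
      have h2 : ∑ i, q ^ k i ≡ q ^ j [MOD (q - 1)] := (h1.trans hn1).trans (hone j).symm
      have := (Nat.modEq_iff_dvd' hlt.le).1 h2.symm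
      rwa [show ∑ i, q ^ k i - q ^ j = N + 1 by omega] at this
    have tz := trivial_zero q hq (N + 1) (by omega) hdvd (M + 1 - j) (by omega)
    have : MvPolynomial.eval (fun i => algebraMap Fq[X] (FractionRing Fq[X]) (X ^ q ^ k i))
        (∑ e ∈ Finset.range (M + 1 - j), tauT Fq (FractionRing Fq[X]) n j (LsT Fq n e)) = 0 := by
      rw [← map_zero (algebraMap Fq[X] (FractionRing Fq[X])), ← tz, map_sum, map_sum]
      refine Finset.sum_congr rfl fun e _ => ?_
      rw [tau_LT q hq, map_sum, map_sum]
      refine Finset.sum_congr rfl fun a ha => ?_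
      have ha0 : algebraMap Fq[X] (FractionRing Fq[X]) a ≠ 0 :=
        (map_ne_zero_iff _ inj).2 ((mem_polyM _ _).1 ha).1.ne_zero
      rw [map_mul, eval_iota, eval_chi q hq, MvPolynomial.eval_C, hN, add_assoc, pow_add, map_mul, ← mul_assoc,
        map_pow, ← mul_pow, inv_mul_cancel₀ ha0, one_pow, one_mul]
    rw [this, mul_zero]

theorem sum_uT_eq_zero (q : ℕ) (hq : q = Fintype.card Fq) (hn : q ≤ n) (hn1 : n % (q - 1) = 1 % (q - 1))
    (D : ℕ → Fq[X]) (h0 : ∀ m, n < m → uT Fq n q D m = 0) (M : ℕ) (hM : n ≤ M) :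
    ∑ m ∈ Finset.range (M + 1), uT Fq n q D m = 0 := by
  have hq1 : 1 < q := hq ▸ Fintype.one_lt_card
  have inj := IsFractionRing.injective Fq[X] (FractionRing Fq[X])
  refine MvPolynomial.funext_set (fun _ => Set.range fun k : ℕ => algebraMap Fq[X] (FractionRing Fq[X]) (X ^ q ^ k)) ?_ ?_
  · intro i
    apply Set.infinite_range_of_injective
    intro a b hab
    have h1 := congrArg natDegree (inj hab)
    simp only [natDegree_X_pow] at h1
    exact Nat.pow_right_injective hq1 h1
  · intro x hx
    have : ∀ i, ∃ k : ℕ, algebraMap Fq[X] (FractionRing Fq[X]) (X ^ q ^ k) = x i := fun i => hx i (Set.mem_univ i)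
    choose k hk using this
    obtain rfl : (fun i => algebraMap Fq[X] (FractionRing Fq[X]) (X ^ q ^ k i)) = x := funext hk
    rw [map_zero, ← exists_M_eval q hq hn hn1 D k (M + ∑ i, q ^ k i) (by omega)]
    congr 1
    apply Finset.sum_subset
    · intro m hm; rw [Finset.mem_range] at *; omega
    · intro m _ hm
      rw [Finset.mem_range] at hm
      exact h0 m (by omega)
end

section TateSide
variable {Fq : Type*} [Field Fq] {n : ℕ}

theorem polyToTate_monomial (m : ℕ) (c : Fq) :
    polyToTate Fq n (monomial m c) = HahnSeries.single (-(m : ℤ)) (MvPolynomial.C c) := by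
  have h : algebraMap Fq (LaurentSeries (MvPolynomial (Fin n) Fq)) c = HahnSeries.C (MvPolynomial.C c) := by
    rw [HahnSeries.algebraMap_apply', PowerSeries.algebraMap_apply, HahnSeries.ofPowerSeries_C,
      MvPolynomial.algebraMap_eq]
  rw [polyToTate, aeval_monomial, thetaTate, HahnSeries.single_pow, h, HahnSeries.C_apply,
    HahnSeries.single_mul_single]
  simp

theorem coeff_polyToTate (a : Fq[X]) (g : ℤ) :
    (polyToTate Fq n a).coeff g = if g ≤ 0 then MvPolynomial.C (a.coeff (-g).toNat) else 0 := by
  induction a using Polynomial.induction_on' with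
  | add p q hp hq =>
    have : polyToTate Fq n (p + q) = polyToTate Fq n p + polyToTate Fq n q := map_add _ _ _
    rw [this, HahnSeries.coeff_add, hp, hq]
    split_ifs <;> simp
  | monomial m c =>
    rw [polyToTate_monomial, HahnSeries.coeff_single, coeff_monomial]
    split_ifs <;> first | rfl | omega | simp

theorem polyToTate_injective : Function.Injective (polyToTate Fq n) := by
  intro a b hab
  ext s
  have h := congrArg (fun x => HahnSeries.coeff x (-(s : ℤ))) hab
  simpa [coeff_polyToTate] using h

theorem order_eq_of {R : Type*} [Zero R] (x : HahnSeries ℤ R) (d : ℤ) (h : x.coeff d ≠ 0)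
    (h' : ∀ g < d, x.coeff g = 0) : x.order = d := by
  apply le_antisymm
  · exact HahnSeries.order_le_of_coeff_ne_zero h
  · have hx : x ≠ 0 := by rintro rfl; simp at h
    rw [HahnSeries.le_order_iff_forall hx]
    exact h'

theorem order_polyToTate {a : Fq[X]} (ha : a ≠ 0) : (polyToTate Fq n a).order = -(a.natDegree : ℤ) := by
  apply order_eq_of
  · rw [coeff_polyToTate]
    simpa using ha
  · intro g hg
    rw [coeff_polyToTate, coeff_eq_zero_of_natDegree_lt (by omega)]
    simp

theorem coeff_bfac (q k : ℕ) (i : Fin n) (g : ℤ) :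
    (HahnSeries.C (MvPolynomial.X i) - (thetaTate Fq n) ^ q ^ k : LaurentSeries (MvPolynomial (Fin n) Fq)).coeff g =
      (if g = 0 then MvPolynomial.X i else 0) - (if g = -((q ^ k : ℕ) : ℤ) then 1 else 0) := by
  rw [thetaTate, HahnSeries.single_pow, HahnSeries.coeff_sub, HahnSeries.C_apply, HahnSeries.coeff_single, HahnSeries.coeff_single]
  simp

theorem order_bfac (q k : ℕ) (hq : 0 < q) (i : Fin n) :
    (HahnSeries.C (MvPolynomial.X i) - (thetaTate Fq n) ^ q ^ k : LaurentSeries (MvPolynomial (Fin n) Fq)).order =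
      -((q ^ k : ℕ) : ℤ) := by
  have hp : 0 < q ^ k := by positivity
  apply order_eq_of
  · rw [coeff_bfac, if_neg (by omega), if_pos rfl]
    simp
  · intro g hg
    rw [coeff_bfac, if_neg (by omega), if_neg (by omega)]
    simp

theorem bfac_ne_zero (q k : ℕ) (hq : 0 < q) (i : Fin n) :
    (HahnSeries.C (MvPolynomial.X i) - (thetaTate Fq n) ^ q ^ k : LaurentSeries (MvPolynomial (Fin n) Fq)) ≠ 0 := by
  have hp : 0 < q ^ k := by positivity
  intro h
  have := order_bfac (Fq := Fq) q k hq i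
  rw [h, HahnSeries.order_zero] at this
  omega

theorem order_prod' {ι R : Type*} [CommRing R] [IsDomain R] (s : Finset ι) (f : ι → HahnSeries ℤ R)
    (h : ∀ i ∈ s, f i ≠ 0) : (∏ i ∈ s, f i).order = ∑ i ∈ s, (f i).order := by
  classical
  induction s using Finset.induction_on with
  | empty => simp
  | insert a s ha ih =>
    rw [Finset.prod_insert ha, Finset.sum_insert ha, HahnSeries.order_mul, ih]
    · exact fun i hi => h i (Finset.mem_insert_of_mem hi)
    · exact h a (Finset.mem_insert_self _ _)
    · exact Finset.prod_ne_zero_iff.2 fun i hi => h i (Finset.mem_insert_of_mem hi)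

theorem order_tateB (q j : ℕ) (hq : 0 < q) : (tateBProd Fq n q j).order = -(n * (∑ k ∈ Finset.range j, q ^ k : ℕ) : ℤ) := by
  rw [tateBProd, order_prod']
  · rw [Finset.sum_congr rfl fun i _ => order_prod' _ _ fun k _ => bfac_ne_zero q k hq i]
    simp only [order_bfac q _ hq]
    simp [Finset.sum_neg_distrib]
  · exact fun i _ => Finset.prod_ne_zero_iff.2 fun k _ => bfac_ne_zero q k hq i

theorem order_tateA (a : Fq[X]) : (tateAProd Fq n a).order = 0 := by
  rw [tateAProd, ← map_prod, HahnSeries.order_C]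

theorem natDegree_D [Fintype Fq] (q : ℕ) (hq : q = Fintype.card Fq) (D : ℕ → Fq[X]) (hD0 : D 0 = 1)
    (hD : ∀ i : ℕ, D (i + 1) = (X ^ q ^ (i + 1) - X) * (D i) ^ q) (j : ℕ) :
    (D j).natDegree = j * q ^ j := by
  have hq1 : 1 < q := hq ▸ Fintype.one_lt_card
  induction j with
  | zero => simp [hD0]
  | succ j ih =>
    have h1 : 1 < q ^ (j + 1) := Nat.one_lt_pow (by omega) hq1
    rw [hD, natDegree_mul (FiniteField.X_pow_card_sub_X_ne_zero _ h1)
      (pow_ne_zero _ (D_ne_zero q hq D hD0 hD j)), FiniteField.X_pow_card_sub_X_natDegree_eq _ h1, natDegree_pow, ih]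
    ring

theorem geom_lt' (q j : ℕ) (hq : 1 < q) : ∑ k ∈ Finset.range j, q ^ k < q ^ j :=
  Nat.geomSum_lt hq (by simp)

theorem coeff_term_zero [Fintype Fq] (q : ℕ) (hq : q = Fintype.card Fq) (D : ℕ → Fq[X]) (hD0 : D 0 = 1)
    (hD : ∀ i : ℕ, D (i + 1) = (X ^ q ^ (i + 1) - X) * (D i) ^ q) (j : ℕ) (a : Fq[X]) (ha : a.Monic)
    (G : LaurentSeries (MvPolynomial (Fin n) Fq))
    (hG : polyToTate Fq n (D j) * (polyToTate Fq n a) ^ q ^ j * G = tateBProd Fq n q j * tateAProd Fq n a)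
    (hm : n < j + a.natDegree) (g : ℤ) (hg : g ≤ 0) : G.coeff g = 0 := by
  have hq1 : 1 < q := hq ▸ Fintype.one_lt_card
  by_cases hG0 : G = 0
  · simp [hG0]
  have h0 : polyToTate Fq n 0 = 0 := by simp [polyToTate]
  have hD' : polyToTate Fq n (D j) ≠ 0 := by
    rw [← h0]; exact fun h => D_ne_zero q hq D hD0 hD j (polyToTate_injective h)
  have ha' : polyToTate Fq n a ≠ 0 := by
    rw [← h0]; exact fun h => ha.ne_zero (polyToTate_injective h)
  have hne : polyToTate Fq n (D j) * (polyToTate Fq n a) ^ q ^ j * G ≠ 0 :=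
    mul_ne_zero (mul_ne_zero hD' (pow_ne_zero _ ha')) hG0
  have hne2 := hne
  rw [hG] at hne2
  have ho := congrArg HahnSeries.order hG
  rw [HahnSeries.order_mul (mul_ne_zero hD' (pow_ne_zero _ ha')) hG0, HahnSeries.order_mul hD' (pow_ne_zero _ ha'),
    HahnSeries.order_pow, HahnSeries.order_mul (left_ne_zero_of_mul hne2) (right_ne_zero_of_mul hne2),
    order_tateB q j (by omega), order_tateA, order_polyToTate (D_ne_zero q hq D hD0 hD j), order_polyToTate ha.ne_zero,
    natDegree_D q hq D hD0 hD] at ho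
  apply HahnSeries.coeff_eq_zero_of_lt_order
  refine lt_of_le_of_lt hg ?_
  have h1 : n * (∑ k ∈ Finset.range j, q ^ k) < j * q ^ j + q ^ j * a.natDegree := by
    have := geom_lt' q j hq1
    calc n * (∑ k ∈ Finset.range j, q ^ k) ≤ n * q ^ j := Nat.mul_le_mul_left _ this.le
      _ < (j + a.natDegree) * q ^ j := Nat.mul_lt_mul_of_pos_right hm (by positivity)
      _ = _ := by ring
  rw [nsmul_eq_mul] at ho
  zify at h1
  push_cast at ho h1 ⊢
  linarith

/-- `polyToTate` as a ring homomorphism. -/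
noncomputable def pTT (Fq : Type*) [Field Fq] (n : ℕ) : Fq[X] →+* LaurentSeries (MvPolynomial (Fin n) Fq) :=
  (aeval (thetaTate Fq n) : Fq[X] →ₐ[Fq] _)

theorem pTT_apply (a : Fq[X]) : pTT Fq n a = polyToTate Fq n a := rfl

/-- `A[t] → T`. -/
noncomputable def psiO (Fq : Type*) [Field Fq] (n : ℕ) :
    MvPolynomial (Fin n) Fq[X] →+* LaurentSeries (MvPolynomial (Fin n) Fq) :=
  MvPolynomial.eval₂Hom (pTT Fq n) (fun i => HahnSeries.C (MvPolynomial.X i))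

theorem coeff_psiO (y : MvPolynomial (Fin n) Fq[X]) (α : Fin n →₀ ℕ) (s : ℕ) :
    MvPolynomial.coeff α ((psiO Fq n y).coeff (-(s : ℤ))) = (MvPolynomial.coeff α y).coeff s := by
  induction y using MvPolynomial.induction_on' with
  | add p q hp hq => simp only [map_add, HahnSeries.coeff_add, MvPolynomial.coeff_add, hp, hq, coeff_add]
  | monomial β p =>
    have h1 : psiO Fq n (MvPolynomial.monomial β p) = HahnSeries.C (MvPolynomial.monomial β 1) * polyToTate Fq n p := by
      rw [psiO, MvPolynomial.coe_eval₂Hom, MvPolynomial.eval₂_monomial, pTT_apply, mul_comm]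
      congr 1
      rw [MvPolynomial.monomial_eq, map_mul, map_one, map_one, one_mul, Finsupp.prod, Finsupp.prod, map_prod]
      simp only [map_pow]
    rw [h1, HahnSeries.C_mul_eq_smul, HahnSeries.coeff_smul, coeff_polyToTate, if_pos (by omega), smul_eq_mul,
      mul_comm, MvPolynomial.coeff_C_mul, MvPolynomial.coeff_monomial, MvPolynomial.coeff_monomial]
    split_ifs <;> simp

theorem psiO_BT (q j : ℕ) : psiO Fq n (BT Fq n q j) = tateBProd Fq n q j := by
  simp [psiO, BT, tateBProd, pTT, thetaTate]

theorem psiO_chi (a : Fq[X]) : psiO Fq n (chiT Fq n a) = tateAProd Fq n a := by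
  rw [chiT, tateAProd, map_prod]
  refine Finset.prod_congr rfl fun i _ => ?_
  induction a using Polynomial.induction_on' with
  | add p q hp hq => simp only [map_add, hp, hq]
  | monomial m c =>
    rw [aeval_monomial, aeval_monomial, map_mul, map_mul, map_pow, map_pow]
    congr 1
    · rw [IsScalarTower.algebraMap_apply Fq Fq[X] (MvPolynomial (Fin n) Fq[X]), MvPolynomial.algebraMap_eq, psiO,
        MvPolynomial.coe_eval₂Hom, MvPolynomial.eval₂_C, pTT_apply, Polynomial.algebraMap_eq, ← monomial_zero_left,
        polyToTate_monomial, MvPolynomial.algebraMap_eq]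
      simp
    · simp [psiO]

theorem comp_pTT_injective (Fq : Type*) [Field Fq] (n : ℕ) : Function.Injective
    ((algebraMap (LaurentSeries (MvPolynomial (Fin n) Fq))
      (FractionRing (LaurentSeries (MvPolynomial (Fin n) Fq)))).comp (pTT Fq n)) := by
  intro a b hab
  have h := IsFractionRing.injective (LaurentSeries (MvPolynomial (Fin n) Fq))
    (FractionRing (LaurentSeries (MvPolynomial (Fin n) Fq))) hab
  exact polyToTate_injective h

/-- `K[t] → Frac T`. -/
noncomputable def psiK (Fq : Type*) [Field Fq] (n : ℕ) :
    MvPolynomial (Fin n) (FractionRing Fq[X]) →+* FractionRing (LaurentSeries (MvPolynomial (Fin n) Fq)) :=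
  MvPolynomial.eval₂Hom
    (IsFractionRing.lift (K := FractionRing Fq[X])
      (g := (algebraMap (LaurentSeries (MvPolynomial (Fin n) Fq)) (FractionRing (LaurentSeries (MvPolynomial (Fin n) Fq)))).comp (pTT Fq n))
      (comp_pTT_injective Fq n))
    (fun i => algebraMap (LaurentSeries (MvPolynomial (Fin n) Fq)) _ (HahnSeries.C (MvPolynomial.X i)))

theorem psiK_iota (y : MvPolynomial (Fin n) Fq[X]) :
    psiK Fq n (iotaT Fq n y) = algebraMap _ _ (psiO Fq n y) := by
  suffices h : (psiK Fq n).comp (iotaT Fq n) = (algebraMap _ _).comp (psiO Fq n) from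
    congrArg (fun f => f y) h
  apply MvPolynomial.ringHom_ext
  · intro a
    simp [psiK, iotaT, psiO]
  · intro i
    simp [psiK, iotaT, psiO]

theorem psiK_kap (a : Fq[X]) :
    psiK Fq n (kapT Fq n a) = algebraMap _ _ (polyToTate Fq n a) := by
  rw [kapT, RingHom.comp_apply, psiK_iota]
  simp [psiO, pTT_apply]
end TateSide

section Final
variable {Fq : Type*} [Field Fq] [Fintype Fq] {n : ℕ}

open Finset.HasAntidiagonal in
theorem psiK_uT (q : ℕ) (hq : q = Fintype.card Fq) (D : ℕ → Fq[X]) (hD0 : D 0 = 1)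
    (hD : ∀ i : ℕ, D (i + 1) = (X ^ q ^ (i + 1) - X) * (D i) ^ q)
    (G : ℕ × Fq[X] → LaurentSeries (MvPolynomial (Fin n) Fq))
    (hG : ∀ (j : ℕ) (a : Polynomial Fq), a.Monic →
      polyToTate Fq n (D j) * (polyToTate Fq n a) ^ q ^ j * G (j, a) =
        tateBProd Fq n q j * tateAProd Fq n a) (m : ℕ) :
    psiK Fq n (uT Fq n q D m) =
      algebraMap _ _ (∑ x ∈ antidiagonal m, ∑ a ∈ polyM Fq x.2, G (x.1, a)) := by
  rw [uT, map_sum, map_sum]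
  refine Finset.sum_congr rfl fun x _ => ?_
  rw [tau_LT q hq, Finset.mul_sum, map_sum, map_sum]
  refine Finset.sum_congr rfl fun a ha => ?_
  have ham := ((mem_polyM _ _).1 ha).1
  have inj := IsFractionRing.injective (LaurentSeries (MvPolynomial (Fin n) Fq)) (FractionRing (LaurentSeries (MvPolynomial (Fin n) Fq)))
  have h1 := congrArg (psiK Fq n) (C_inv_kap (n := n) (D_ne_zero q hq D hD0 hD x.1))
  have h2 := congrArg (psiK Fq n) (C_inv_kap (n := n) ham.ne_zero)
  have h2 := congrArg (fun z => z ^ q ^ x.1) h2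
  rw [map_mul, map_one, psiK_kap] at h1 h2
  have h3 := congrArg (algebraMap _ (FractionRing (LaurentSeries (MvPolynomial (Fin n) Fq)))) (hG x.1 a ham)
  rw [mul_pow, one_pow] at h2
  simp only [map_mul, map_pow] at h3 ⊢
  rw [psiK_iota, psiK_iota, psiO_BT, psiO_chi]
  set d' := psiK Fq n (MvPolynomial.C (algebraMap Fq[X] (FractionRing Fq[X]) (D x.1))⁻¹)
  set a' := psiK Fq n (MvPolynomial.C (algebraMap Fq[X] (FractionRing Fq[X]) a)⁻¹) ^ q ^ x.1
  set d := algebraMap _ (FractionRing (LaurentSeries (MvPolynomial (Fin n) Fq))) (polyToTate Fq n (D x.1))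
  set b := (algebraMap _ (FractionRing (LaurentSeries (MvPolynomial (Fin n) Fq))) (polyToTate Fq n a)) ^ q ^ x.1
  set g := algebraMap _ (FractionRing (LaurentSeries (MvPolynomial (Fin n) Fq))) (G (x.1, a))
  linear_combination (-d' * a') * h3 + (a' * b * g) * h1 + g * h2

theorem uT_zero (q : ℕ) (hq : q = Fintype.card Fq) (D : ℕ → Fq[X]) (hD0 : D 0 = 1)
    (hD : ∀ i : ℕ, D (i + 1) = (X ^ q ^ (i + 1) - X) * (D i) ^ q)
    (G : ℕ × Fq[X] → LaurentSeries (MvPolynomial (Fin n) Fq))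
    (hG : ∀ (j : ℕ) (a : Polynomial Fq), a.Monic →
      polyToTate Fq n (D j) * (polyToTate Fq n a) ^ q ^ j * G (j, a) =
        tateBProd Fq n q j * tateAProd Fq n a) (m : ℕ) (hm : n < m) :
    uT Fq n q D m = 0 := by
  obtain ⟨y, hy⟩ := uT_integral (n := n) q hq D hD0 hD m
  have h1 := psiK_uT q hq D hD0 hD G hG m
  rw [hy, psiK_iota] at h1
  have h2 := IsFractionRing.injective _ _ h1
  suffices y = 0 by rw [hy, this, map_zero]
  ext α s
  rw [← coeff_psiO, h2, HahnSeries.coeff_sum, Finset.sum_eq_zero]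
  · simp
  · intro x hx
    rw [Finset.HasAntidiagonal.mem_antidiagonal] at hx
    rw [HahnSeries.coeff_sum]
    refine Finset.sum_eq_zero fun a ha => ?_
    rw [mem_polyM] at ha
    exact coeff_term_zero q hq D hD0 hD x.1 a ha.1 _ (hG x.1 a ha.1) (by omega) _ (by omega)
end Final

theorem exp_of_L_series_eq_zero
    (Fq : Type*) [Field Fq] [Fintype Fq]
    (q : ℕ) (hq : q = Fintype.card Fq)
    (n : ℕ) (hn : q ≤ n) (hn1 : n % (q - 1) = 1 % (q - 1))
    (D : ℕ → Polynomial Fq) (hD0 : D 0 = 1)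
    (hD : ∀ i : ℕ, D (i + 1) =
      (Polynomial.X ^ q ^ (i + 1) - Polynomial.X) * (D i) ^ q)
    (G : HahnSeries.SummableFamily ℤ (MvPolynomial (Fin n) Fq)
      (ℕ × Polynomial Fq))
    (hG : ∀ (j : ℕ) (a : Polynomial Fq), a.Monic →
      polyToTate Fq n (D j) * (polyToTate Fq n a) ^ q ^ j * G (j, a) =
        tateBProd Fq n q j * tateAProd Fq n a)
    (hG' : ∀ (j : ℕ) (a : Polynomial Fq), ¬ a.Monic → G (j, a) = 0) :
    G.hsum = 0 := by
  classical
  ext1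
  funext g
  have hfin : {x | (G x).coeff g ≠ 0}.Finite := G.finite_co_support g
  set S := hfin.toFinset with hS
  set M := n + S.sup (fun x => x.1 + x.2.natDegree) with hM
  let Z := (Finset.range (M + 1)).sigma fun m =>
    (Finset.HasAntidiagonal.antidiagonal m).sigma fun x => polyM Fq x.2
  let f : (Σ _ : ℕ, Σ _ : ℕ × ℕ, Fq[X]) → ℕ × Fq[X] := fun z => (z.2.1.1, z.2.2)
  have hmemZ : ∀ z, z ∈ Z ↔ z.1 ≤ M ∧ z.2.1.1 + z.2.1.2 = z.1 ∧ z.2.2.Monic ∧ z.2.2.natDegree = z.2.1.2 := by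
    intro z
    simp only [Z, Finset.mem_sigma, Finset.mem_range, Finset.HasAntidiagonal.mem_antidiagonal, mem_polyM]
    rw [Nat.lt_succ_iff]
  have hsub : {x | (G x).coeff g ≠ 0} ⊆ (Z.image f : Finset (ℕ × Fq[X])) := by
    rintro ⟨j, a⟩ hx
    have ham : a.Monic := by
      by_contra h
      exact hx (by rw [hG' j a h]; rfl)
    have hxS : (j, a) ∈ S := by
      rw [hS, Set.Finite.mem_toFinset]; exact hx
    have hle : j + a.natDegree ≤ S.sup (fun x => x.1 + x.2.natDegree) :=
      Finset.le_sup (f := fun x : ℕ × Fq[X] => x.1 + x.2.natDegree) hxS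
    rw [Finset.mem_coe, Finset.mem_image]
    refine ⟨⟨j + a.natDegree, ⟨(j, a.natDegree), a⟩⟩, ?_, rfl⟩
    rw [hmemZ]
    exact ⟨by dsimp only; omega, rfl, ham, rfl⟩
  have hinj : Set.InjOn f Z := by
    rintro ⟨m, ⟨⟨j, e⟩, a⟩⟩ h ⟨m', ⟨⟨j', e'⟩, a'⟩⟩ h' hh
    rw [Finset.mem_coe, hmemZ] at h h'
    simp only [f, Prod.mk.injEq] at hh
    dsimp only at h h'
    obtain ⟨rfl, rfl⟩ := hh
    obtain ⟨_, rfl, _, rfl⟩ := h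
    obtain ⟨_, rfl, _, rfl⟩ := h'
    rfl
  rw [HahnSeries.SummableFamily.coeff_hsum_eq_sum_of_subset hsub, Finset.sum_image hinj]
  have h0 := sum_uT_eq_zero q hq hn hn1 D (uT_zero q hq D hD0 hD G hG) M (by omega)
  have h1 := congrArg (psiK Fq n) h0
  rw [map_sum, map_zero, Finset.sum_congr rfl fun m _ => psiK_uT q hq D hD0 hD G hG m, ← map_sum,
    ← map_zero (algebraMap (LaurentSeries (MvPolynomial (Fin n) Fq)) (FractionRing (LaurentSeries (MvPolynomial (Fin n) Fq))))] at h1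
  have h2 := IsFractionRing.injective _ _ h1
  have h3 := congrArg (fun z => HahnSeries.coeff z g) h2
  simp only [HahnSeries.coeff_sum] at h3
  rw [HahnSeries.coeff_zero] at h3 ⊢
  rw [← h3]
  simp only [Z, Finset.sum_sigma, f]
end

section
/- Let C be the Carlitz module over A = F_q[θ] (C_θ = τ + θ), with exponential exp_C and logarithm log_C. Then K_∞ = log_C(1)·A ⊕ M_∞ where M_∞ = {x ∈ K_∞ : v_∞(x) ≥ 1}, and consequently A ∩ exp_C(K_∞) = 𝓜 := {C_a(1) : a ∈ A}; in particular 𝓜 equals its radical √𝓜 = {b ∈ A : ∃ a ∈ A∖{0}, C_a(b) ∈ 𝓜}. -/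
open Polynomial

namespace Carl

variable {Fq : Type*} [Field Fq]

/-- valuation at least `n` -/
def V (n : ℤ) (x : LaurentSeries Fq) : Prop := ∀ i : ℤ, i < n → x.coeff i = 0

theorem V_iff (n : ℤ) (x : LaurentSeries Fq) : V n x ↔ (n : WithTop ℤ) ≤ x.orderTop := by
  rw [HahnSeries.le_orderTop_iff_forall]
  simp [V]

theorem V.mono {m n : ℤ} {x : LaurentSeries Fq} (h : V n x) (hmn : m ≤ n) : V m x :=
  fun i hi => h i (lt_of_lt_of_le hi hmn)

theorem V.zero (n : ℤ) : V n (0 : LaurentSeries Fq) := fun i _ => by simp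

theorem V.add {n : ℤ} {x y : LaurentSeries Fq} (hx : V n x) (hy : V n y) : V n (x + y) :=
  fun i hi => by simp [hx i hi, hy i hi]

theorem V.sub {n : ℤ} {x y : LaurentSeries Fq} (hx : V n x) (hy : V n y) : V n (x - y) :=
  fun i hi => by simp [hx i hi, hy i hi]

theorem V.neg {n : ℤ} {x : LaurentSeries Fq} (hx : V n x) : V n (-x) :=
  fun i hi => by simp [hx i hi]

theorem V.smul {n : ℤ} {x : LaurentSeries Fq} (c : Fq) (hx : V n x) : V n (c • x) :=
  fun i hi => by simp [hx i hi]

theorem V.sum {ι : Type*} {n : ℤ} {s : Finset ι} {f : ι → LaurentSeries Fq}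
    (h : ∀ i ∈ s, V n (f i)) : V n (∑ i ∈ s, f i) := by
  classical
  induction s using Finset.induction_on with
  | empty => simpa using V.zero n
  | insert a s ha ih =>
    rw [Finset.sum_insert ha]
    exact (h _ (Finset.mem_insert_self _ _)).add
      (ih fun i hi => h i (Finset.mem_insert_of_mem hi))

theorem V.mul {m n : ℤ} {x y : LaurentSeries Fq} (hx : V m x) (hy : V n y) :
    V (m + n) (x * y) := by
  rw [V_iff] at *
  rw [HahnSeries.orderTop_mul]
  push_cast
  exact add_le_add hx hy

theorem V.one : V 0 (1 : LaurentSeries Fq) := by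
  rw [V_iff, HahnSeries.orderTop_one]; rfl

theorem V.pow {m : ℤ} {x : LaurentSeries Fq} (hx : V m x) (k : ℕ) : V (k * m) (x ^ k) := by
  induction k with
  | zero => simpa using V.one
  | succ k ih =>
    rw [pow_succ]
    exact (ih.mul hx).mono (by push_cast; linarith)

theorem V.eq_zero {x : LaurentSeries Fq} (h : ∀ N : ℕ, V N x) : x = 0 := by
  ext i
  exact h (i.toNat + 1) i (by have := Int.self_le_toNat i; push_cast; omega)

theorem V_order (x : LaurentSeries Fq) : V x.order x :=
  fun _ hi => HahnSeries.coeff_eq_zero_of_lt_order hi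

theorem V.inv {m : ℤ} {x : LaurentSeries Fq} (hx : x.coeff (-m) ≠ 0) : V m x⁻¹ := by
  have hx0 : x ≠ 0 := by rintro rfl; simp at hx
  have h1 := HahnSeries.order_le_of_coeff_ne_zero hx
  have h2 := HahnSeries.order_mul hx0 (inv_ne_zero hx0)
  rw [mul_inv_cancel₀ hx0, HahnSeries.order_one] at h2
  exact (V_order _).mono (by omega)

/-- the family of partial sums converges -/
def HS (f : ℕ → LaurentSeries Fq) (s : LaurentSeries Fq) : Prop :=
  ∀ N : ℕ, ∃ J : ℕ, ∀ n ≥ J, V N (s - ∑ j ∈ Finset.range n, f j)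

theorem HS.unique {f : ℕ → LaurentSeries Fq} {s t : LaurentSeries Fq} (hs : HS f s) (ht : HS f t) :
    s = t := by
  rw [← sub_eq_zero]
  apply V.eq_zero
  intro N
  obtain ⟨J, hJ⟩ := hs N
  obtain ⟨J', hJ'⟩ := ht N
  have := (hJ (max J J') (le_max_left _ _)).sub (hJ' (max J J') (le_max_right _ _))
  simpa using this

theorem HS.add {f g : ℕ → LaurentSeries Fq} {s t : LaurentSeries Fq} (hs : HS f s) (ht : HS g t) :
    HS (fun j => f j + g j) (s + t) := by
  intro N
  obtain ⟨J, hJ⟩ := hs N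
  obtain ⟨J', hJ'⟩ := ht N
  refine ⟨max J J', fun n hn => ?_⟩
  have := (hJ n (le_trans (le_max_left _ _) hn)).add (hJ' n (le_trans (le_max_right _ _) hn))
  rw [Finset.sum_add_distrib]
  convert this using 1
  ring

theorem HS.smul {f : ℕ → LaurentSeries Fq} {s : LaurentSeries Fq} (c : Fq) (hs : HS f s) :
    HS (fun j => c • f j) (c • s) := by
  intro N
  obtain ⟨J, hJ⟩ := hs N
  refine ⟨J, fun n hn => ?_⟩
  rw [← Finset.smul_sum, ← smul_sub]
  exact (hJ n hn).smul c

theorem HS.mul {f : ℕ → LaurentSeries Fq} {s : LaurentSeries Fq} (c : LaurentSeries Fq) {m : ℕ}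
    (hc : V (-m) c) (hs : HS f s) : HS (fun j => c * f j) (c * s) := by
  intro N
  obtain ⟨J, hJ⟩ := hs (N + m)
  refine ⟨J, fun n hn => ?_⟩
  rw [← Finset.mul_sum, ← mul_sub]
  exact (hc.mul (hJ n hn)).mono (by push_cast; omega)

theorem HS.shift {f : ℕ → LaurentSeries Fq} {s : LaurentSeries Fq} (h0 : f 0 = 0)
    (hs : HS (fun j => f (j + 1)) s) : HS f s := by
  intro N
  obtain ⟨J, hJ⟩ := hs N
  refine ⟨J + 1, fun n hn => ?_⟩
  obtain ⟨k, rfl⟩ : ∃ k, n = k + 1 := ⟨n - 1, by omega⟩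
  rw [Finset.sum_range_succ', h0, add_zero]
  exact hJ k (by omega)

theorem exists_V (x : LaurentSeries Fq) : ∃ m : ℕ, V (-m) x :=
  ⟨(-x.order).toNat, (V_order x).mono (by have := Int.self_le_toNat (-x.order); omega)⟩

/-- families whose terms tend to zero are summable -/
def mkFam (f : ℕ → LaurentSeries Fq) (h : ∀ N : ℕ, ∃ J : ℕ, ∀ j ≥ J, V N (f j)) :
    HahnSeries.SummableFamily ℤ Fq ℕ where
  toFun := f
  isPWO_iUnion_support' := by
    refine (BddBelow.isWF ?_).isPWO
    obtain ⟨J, hJ⟩ := h 0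
    have : ∃ B : ℕ, ∀ j < J, V (-B) (f j) := by
      clear hJ
      induction J with
      | zero => exact ⟨0, by simp⟩
      | succ J ih =>
        obtain ⟨B, hB⟩ := ih
        obtain ⟨m, hm⟩ := exists_V (f J)
        refine ⟨max B m, fun j hj => ?_⟩
        rcases Nat.lt_succ_iff_lt_or_eq.1 hj with hj | rfl
        · exact (hB j hj).mono (by push_cast; omega)
        · exact hm.mono (by push_cast; omega)
    obtain ⟨B, hB⟩ := this
    refine ⟨-B, ?_⟩
    intro i hi
    simp only [Set.mem_iUnion, HahnSeries.mem_support] at hi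
    obtain ⟨j, hj⟩ := hi
    by_contra hlt
    push Not at hlt
    apply hj
    rcases lt_or_ge j J with h' | h'
    · exact hB j h' i hlt
    · exact hJ j h' i (by push_cast; omega)
  finite_co_support' := by
    intro g
    obtain ⟨J, hJ⟩ := h (g.toNat + 1)
    refine (Set.finite_lt_nat J).subset ?_
    intro j hj
    by_contra hlt
    simp only [Set.mem_ofPred_eq, not_lt] at hlt
    exact hj (hJ j hlt g (by have := Int.self_le_toNat g; push_cast; omega))

theorem mkFam_apply (f : ℕ → LaurentSeries Fq) (h) (j : ℕ) : mkFam f h j = f j := rfl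

theorem V_hsum (F : HahnSeries.SummableFamily ℤ Fq ℕ) (N : ℤ) (n : ℕ) (h : ∀ j ≥ n, V N (F j)) :
    V N (F.hsum - ∑ j ∈ Finset.range n, F j) := by
  intro i hi
  rw [HahnSeries.coeff_sub, HahnSeries.SummableFamily.coeff_hsum_eq_sum_of_subset
    (t := Finset.range n), HahnSeries.coeff_sum, sub_self]
  intro j hj
  by_contra hlt
  simp only [Finset.coe_range, Set.mem_Iio, not_lt] at hlt
  exact hj (h j hlt i hi)

/-! ### the Carlitz sequences -/

/-- θ -/
noncomputable def th (Fq : Type*) [Field Fq] : LaurentSeries Fq := HahnSeries.single (-1 : ℤ) 1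

theorem th_pow (n : ℕ) : th Fq ^ n = HahnSeries.single (-n : ℤ) 1 := by
  rw [th, HahnSeries.single_pow]; simp

theorem V_th_pow (n : ℕ) : V (-n) (th Fq ^ n) := by
  rw [th_pow]
  intro i hi
  exact HahnSeries.coeff_single_of_ne hi.ne

theorem V_th : V (-1) (th Fq) := by
  simpa using V_th_pow (Fq := Fq) 1

/-- D_j in K_∞ -/
noncomputable def cD (Fq : Type*) [Field Fq] (q : ℕ) : ℕ → LaurentSeries Fq
  | 0 => 1
  | i + 1 => (th Fq ^ q ^ (i + 1) - th Fq) * (cD Fq q i) ^ q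

/-- ℓ_j in K_∞ -/
noncomputable def cL (Fq : Type*) [Field Fq] (q : ℕ) : ℕ → LaurentSeries Fq
  | 0 => 1
  | i + 1 => (th Fq - th Fq ^ q ^ (i + 1)) * cL Fq q i

theorem coeff_br (m : ℕ) (hm : 2 ≤ m) : (th Fq ^ m - th Fq).coeff (-m) ≠ 0 := by
  rw [th_pow, th, HahnSeries.coeff_sub, HahnSeries.coeff_single_same,
    HahnSeries.coeff_single_of_ne (by omega)]
  simp

theorem br_ne (m : ℕ) (hm : 2 ≤ m) : th Fq ^ m - th Fq ≠ 0 := by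
  intro h
  have := coeff_br (Fq := Fq) m hm
  rw [h] at this
  simp at this

theorem two_le_qpow {q : ℕ} (hq : 2 ≤ q) (i : ℕ) : 2 ≤ q ^ (i + 1) :=
  hq.trans (Nat.le_self_pow (by omega) q)

theorem cD_ne {q : ℕ} (hq : 2 ≤ q) (i : ℕ) : cD Fq q i ≠ 0 := by
  induction i with
  | zero => simp [cD]
  | succ i ih => exact mul_ne_zero (br_ne _ (two_le_qpow hq i)) (pow_ne_zero _ ih)

theorem cL_ne {q : ℕ} (hq : 2 ≤ q) (i : ℕ) : cL Fq q i ≠ 0 := by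
  induction i with
  | zero => simp [cL]
  | succ i ih =>
    refine mul_ne_zero ?_ ih
    rw [← neg_sub]
    exact neg_ne_zero.2 (br_ne _ (two_le_qpow hq i))

theorem V_cD {q : ℕ} (hq : 2 ≤ q) (i : ℕ) : V (q ^ i * i) (cD Fq q i)⁻¹ := by
  induction i with
  | zero => simpa [cD] using V.one
  | succ i ih =>
    rw [cD, mul_inv, ← inv_pow]
    refine ((V.inv (coeff_br _ (two_le_qpow hq i))).mul (ih.pow q)).mono ?_
    push_cast
    apply le_of_eq
    ring

theorem V_cL {q : ℕ} (hq : 2 ≤ q) (i : ℕ) : V i (cL Fq q i)⁻¹ := by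
  induction i with
  | zero => simpa [cL] using V.one
  | succ i ih =>
    rw [cL, mul_inv, ← neg_sub, inv_neg]
    refine ((V.inv (coeff_br _ (two_le_qpow hq i))).neg.mul ih).mono ?_
    have := two_le_qpow hq i
    zify at this
    push_cast
    linarith


/-! ### Frobenius -/

section Frob
variable [Fintype Fq]

theorem fr_add {q : ℕ} (hq : q = Fintype.card Fq) (x y : LaurentSeries Fq) :
    (x + y) ^ q = x ^ q + y ^ q := by
  subst hq
  exact map_add (FiniteField.frobeniusAlgHom Fq (LaurentSeries Fq)) x y

theorem fr_smul {q : ℕ} (hq : q = Fintype.card Fq) (c : Fq) (x : LaurentSeries Fq) :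
    (c • x) ^ q = c • x ^ q := by
  subst hq
  rw [← HahnSeries.C_mul_eq_smul, ← HahnSeries.C_mul_eq_smul, mul_pow, ← map_pow,
    FiniteField.pow_card]

theorem q_ge {q : ℕ} (hq : q = Fintype.card Fq) : 2 ≤ q := by
  subst hq
  exact Fintype.one_lt_card

theorem frj_add {q : ℕ} (hq : q = Fintype.card Fq) (j : ℕ) (x y : LaurentSeries Fq) :
    (x + y) ^ q ^ j = x ^ q ^ j + y ^ q ^ j := by
  induction j with
  | zero => simp
  | succ j ih => rw [pow_succ, pow_mul, ih, fr_add hq, ← pow_mul, ← pow_mul]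

theorem frj_smul {q : ℕ} (hq : q = Fintype.card Fq) (j : ℕ) (c : Fq) (x : LaurentSeries Fq) :
    (c • x) ^ q ^ j = c • x ^ q ^ j := by
  induction j with
  | zero => simp
  | succ j ih => rw [pow_succ, pow_mul, ih, fr_smul hq, ← pow_mul]

theorem frj_neg {q : ℕ} (hq : q = Fintype.card Fq) (j : ℕ) (x : LaurentSeries Fq) :
    (-x) ^ q ^ j = -x ^ q ^ j := by
  have := frj_smul hq j (-1) x
  simpa using this

theorem frj_sub {q : ℕ} (hq : q = Fintype.card Fq) (j : ℕ) (x y : LaurentSeries Fq) :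
    (x - y) ^ q ^ j = x ^ q ^ j - y ^ q ^ j := by
  rw [sub_eq_add_neg, frj_add hq, frj_neg hq, ← sub_eq_add_neg]

theorem frj_sum {q : ℕ} (hq : q = Fintype.card Fq) (j : ℕ) {ι : Type*} (s : Finset ι)
    (f : ι → LaurentSeries Fq) :
    (∑ i ∈ s, f i) ^ q ^ j = ∑ i ∈ s, f i ^ q ^ j := by
  classical
  have hq2 := q_ge hq
  induction s using Finset.induction_on with
  | empty =>
    have : q ^ j ≠ 0 := pow_ne_zero _ (by omega)
    rw [Finset.sum_empty, Finset.sum_empty, zero_pow this]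
  | insert a s ha ih => rw [Finset.sum_insert ha, Finset.sum_insert ha, frj_add hq, ih]

theorem fr_sum {q : ℕ} (hq : q = Fintype.card Fq) {ι : Type*} (s : Finset ι)
    (f : ι → LaurentSeries Fq) :
    (∑ i ∈ s, f i) ^ q = ∑ i ∈ s, f i ^ q := by
  simpa using frj_sum hq 1 s f

theorem HS.frob {q : ℕ} (hq : q = Fintype.card Fq) {f : ℕ → LaurentSeries Fq}
    {s : LaurentSeries Fq} (hs : HS f s) : HS (fun j => f j ^ q) (s ^ q) := by
  have hq2 := q_ge hq
  intro N
  obtain ⟨J, hJ⟩ := hs N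
  refine ⟨J, fun n hn => ?_⟩
  rw [← fr_sum hq]
  have h1 := frj_sub hq 1 s (∑ j ∈ Finset.range n, f j)
  rw [pow_one] at h1
  rw [← h1]
  refine ((hJ n hn).pow q).mono ?_
  have : (2 : ℤ) ≤ q := by exact_mod_cast hq2
  nlinarith

/-- `j`-th term of the exponential series -/
noncomputable def tm (q : ℕ) (x : LaurentSeries Fq) (j : ℕ) : LaurentSeries Fq :=
  (cD Fq q j)⁻¹ * x ^ q ^ j

theorem V_tm {q : ℕ} (hq : 2 ≤ q) {m : ℤ} {x : LaurentSeries Fq} (hx : V m x) (j : ℕ) :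
    V (q ^ j * (j + m)) (tm q x j) := by
  refine ((V_cD hq j).mul (hx.pow (q ^ j))).mono ?_
  push_cast
  apply le_of_eq
  ring

theorem V_tm' {q : ℕ} (hq : 2 ≤ q) {m : ℤ} {x : LaurentSeries Fq} (hx : V m x) (j : ℕ)
    (h : 0 ≤ j + m) : V (j + m) (tm q x j) := by
  refine (V_tm hq hx j).mono ?_
  have : (1 : ℤ) ≤ q ^ j := by exact_mod_cast Nat.one_le_pow _ _ (by omega)
  nlinarith

theorem tm_tends {q : ℕ} (hq : 2 ≤ q) (x : LaurentSeries Fq) :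
    ∀ N : ℕ, ∃ J : ℕ, ∀ j ≥ J, V N (tm q x j) := by
  intro N
  obtain ⟨m, hm⟩ := exists_V x
  exact ⟨N + m, fun j hj => (V_tm' hq hm j (by omega)).mono (by omega)⟩

/-- `e` is the Carlitz exponential -/
def IsE (q : ℕ) (e : LaurentSeries Fq → LaurentSeries Fq) : Prop :=
  ∀ (x : LaurentSeries Fq) (N : ℤ) (n : ℕ), (∀ j ≥ n, V N (tm q x j)) →
    V N (e x - ∑ j ∈ Finset.range n, tm q x j)

theorem isE_of {q : ℕ} (hq : 2 ≤ q) {e : LaurentSeries Fq → LaurentSeries Fq}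
    (h : ∀ (x : LaurentSeries Fq) (F : HahnSeries.SummableFamily ℤ Fq ℕ),
      (∀ j : ℕ, cD Fq q j * F j = x ^ q ^ j) → e x = F.hsum) : IsE q e := by
  intro x N n hn
  have h1 := h x (mkFam _ (tm_tends hq x)) (fun j => by
    rw [mkFam_apply, tm, mul_inv_cancel_left₀ (cD_ne hq j)])
  rw [h1]
  exact V_hsum (mkFam _ (tm_tends hq x)) N n hn

theorem IsE.hs {q : ℕ} (hq : 2 ≤ q) {e : LaurentSeries Fq → LaurentSeries Fq} (he : IsE q e)
    (x : LaurentSeries Fq) : HS (tm q x) (e x) := by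
  intro N
  obtain ⟨J, hJ⟩ := tm_tends hq x N
  exact ⟨J, fun n hn => he x N n fun j hj => hJ j (hn.trans hj)⟩

theorem IsE.V {q : ℕ} (hq : 2 ≤ q) {e : LaurentSeries Fq → LaurentSeries Fq} (he : IsE q e)
    {x : LaurentSeries Fq} {n : ℕ} (hx : V n x) : V n (e x) := by
  have := he x n 0 (fun j _ => (V_tm' hq hx j (by omega)).mono (by omega))
  simpa using this

theorem IsE.add {q : ℕ} (hq : q = Fintype.card Fq) {e : LaurentSeries Fq → LaurentSeries Fq}
    (he : IsE q e) (x y : LaurentSeries Fq) : e (x + y) = e x + e y := by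
  have hq2 := q_ge hq
  refine (he.hs hq2 (x + y)).unique ?_
  convert (he.hs hq2 x).add (he.hs hq2 y) using 2 with j
  rw [tm, tm, tm, frj_add hq, mul_add]

theorem IsE.smul {q : ℕ} (hq : q = Fintype.card Fq) {e : LaurentSeries Fq → LaurentSeries Fq}
    (he : IsE q e) (c : Fq) (x : LaurentSeries Fq) : e (c • x) = c • e x := by
  have hq2 := q_ge hq
  refine (he.hs hq2 (c • x)).unique ?_
  convert (he.hs hq2 x).smul c using 2 with j
  rw [tm, tm, frj_smul hq, ← HahnSeries.C_mul_eq_smul, ← HahnSeries.C_mul_eq_smul]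
  ring

theorem IsE.sub {q : ℕ} (hq : q = Fintype.card Fq) {e : LaurentSeries Fq → LaurentSeries Fq}
    (he : IsE q e) (x y : LaurentSeries Fq) : e (x - y) = e x - e y := by
  rw [eq_sub_iff_add_eq, ← he.add hq, sub_add_cancel]

theorem IsE.theta {q : ℕ} (hq : q = Fintype.card Fq) {e : LaurentSeries Fq → LaurentSeries Fq}
    (he : IsE q e) (x : LaurentSeries Fq) : e (th Fq * x) = e x ^ q + th Fq * e x := by
  have hq2 := q_ge hq
  refine (he.hs hq2 _).unique ?_
  have h1 : HS (fun j => (th Fq ^ q ^ j - th Fq) * tm q x j) (e x ^ q) := by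
    apply HS.shift
    · simp
    convert (he.hs hq2 x).frob hq using 2 with j
    rw [tm, tm, cD]
    have := br_ne (Fq := Fq) _ (two_le_qpow hq2 j)
    rw [mul_pow, ← pow_mul, ← pow_succ, inv_pow]
    field_simp
  convert h1.add ((he.hs hq2 x).mul (th Fq) (m := 1) (by simpa using V_th)) using 2 with j
  rw [tm, tm, mul_pow]
  ring

/-- terms of the double series -/
noncomputable def tt (Fq : Type*) [Field Fq] (q : ℕ) (i j : ℕ) : LaurentSeries Fq :=
  (cD Fq q i)⁻¹ * (cL Fq q j)⁻¹ ^ q ^ i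

theorem tt_left {q : ℕ} (hq : q = Fintype.card Fq) (i j : ℕ) :
    (th Fq ^ q ^ (i + 1) - th Fq) * tt Fq q (i + 1) j = tt Fq q i j ^ q := by
  have := br_ne (Fq := Fq) _ (two_le_qpow (q_ge hq) i)
  rw [tt, tt, cD, mul_pow, ← pow_mul, ← pow_succ, inv_pow (cD Fq q i)]
  field_simp

theorem tt_right {q : ℕ} (hq : q = Fintype.card Fq) (i j : ℕ) :
    (th Fq ^ q ^ (i + (j + 1)) - th Fq ^ q ^ i) * tt Fq q i (j + 1) = - tt Fq q i j := by
  have := br_ne (Fq := Fq) _ (two_le_qpow (q_ge hq) j)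
  have h2 := cL_ne (Fq := Fq) (q_ge hq) j
  rw [tt, tt, cL, add_comm i, pow_add q (j + 1) i, pow_mul, ← frj_sub hq, mul_left_comm, ← mul_pow,
    ← mul_neg, ← frj_neg hq]
  congr 2
  rw [← neg_sub (th Fq ^ q ^ (j + 1)), mul_inv, inv_neg, neg_mul, mul_neg,
    mul_inv_cancel_left₀ this]

theorem tt_sum {q : ℕ} (hq : q = Fintype.card Fq) (m : ℕ) :
    ∑ p ∈ Finset.HasAntidiagonal.antidiagonal (m + 1), tt Fq q p.1 p.2 = 0 := by
  have key : ∀ m, (th Fq ^ q ^ (m + 1) - th Fq) *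
      ∑ p ∈ Finset.HasAntidiagonal.antidiagonal (m + 1), tt Fq q p.1 p.2 =
      (∑ p ∈ Finset.HasAntidiagonal.antidiagonal m, tt Fq q p.1 p.2) ^ q -
        ∑ p ∈ Finset.HasAntidiagonal.antidiagonal m, tt Fq q p.1 p.2 := by
    intro m
    have h1 : ∑ p ∈ Finset.HasAntidiagonal.antidiagonal (m + 1), (th Fq ^ q ^ p.1 - th Fq) * tt Fq q p.1 p.2
        = (∑ p ∈ Finset.HasAntidiagonal.antidiagonal m, tt Fq q p.1 p.2) ^ q := by
      rw [Finset.Nat.sum_antidiagonal_succ, fr_sum hq]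
      simp [tt_left hq]
    have h2 : ∑ p ∈ Finset.HasAntidiagonal.antidiagonal (m + 1),
        (th Fq ^ q ^ (p.1 + p.2) - th Fq ^ q ^ p.1) * tt Fq q p.1 p.2
        = - ∑ p ∈ Finset.HasAntidiagonal.antidiagonal m, tt Fq q p.1 p.2 := by
      rw [Finset.Nat.sum_antidiagonal_succ']
      simp [tt_right hq]
    rw [sub_eq_add_neg (_ ^ q), ← h1, ← h2, ← Finset.sum_add_distrib, Finset.mul_sum]
    refine Finset.sum_congr rfl fun p hp => ?_
    rw [Finset.HasAntidiagonal.mem_antidiagonal.1 hp]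
    ring
  have hq2 := q_ge hq
  have hb := br_ne (Fq := Fq) _ (two_le_qpow hq2 m)
  have : (th Fq ^ q ^ (m + 1) - th Fq) *
      ∑ p ∈ Finset.HasAntidiagonal.antidiagonal (m + 1), tt Fq q p.1 p.2 = 0 := by
    rw [key]
    cases m with
    | zero => simp [tt, cD, cL]
    | succ m => rw [tt_sum hq m]; simp; omega
  exact (mul_eq_zero.1 this).resolve_left hb

theorem V_tt {q : ℕ} (hq : 2 ≤ q) (i j : ℕ) : V (i + j) (tt Fq q i j) :=
  V_tm' hq (V_cL hq j) i (by omega)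

/-- partial sums of log 1 -/
noncomputable def Sn (Fq : Type*) [Field Fq] (q n : ℕ) : LaurentSeries Fq :=
  ∑ j ∈ Finset.range n, (cL Fq q j)⁻¹

theorem V_Sn {q : ℕ} (hq : 2 ≤ q) (n : ℕ) : V 0 (Sn Fq q n) :=
  V.sum fun j _ => (V_cL hq j).mono (by omega)

theorem exp_log_one {q : ℕ} (hq : q = Fintype.card Fq) {e : LaurentSeries Fq → LaurentSeries Fq}
    (he : IsE q e) {lam : LaurentSeries Fq} (hl : ∀ n : ℕ, V n (lam - Sn Fq q n)) : e lam = 1 := by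
  have hq2 := q_ge hq
  rw [← sub_eq_zero]
  apply V.eq_zero
  intro N
  suffices h : ∀ n : ℕ, V (n + 1 : ℕ) (e lam - 1) from (h N).mono (by push_cast; omega)
  intro n
  have h1 := he.V hq2 (hl (n + 1))
  rw [he.sub hq] at h1
  have h2 : V ((n + 1 : ℕ) : ℤ)
      (e (Sn Fq q (n + 1)) - ∑ i ∈ Finset.range (n + 1), tm q (Sn Fq q (n + 1)) i) :=
    he _ _ _ fun j hj => (V_tm' hq2 (V_Sn hq2 _) j (by omega)).mono (by omega)
  have h3 : V ((n + 1 : ℕ) : ℤ) (∑ i ∈ Finset.range (n + 1), (tm q (Sn Fq q (n + 1)) i -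
      ∑ j ∈ Finset.range (n + 1 - i), tt Fq q i j)) := by
    apply V.sum
    intro i hi
    have hle : n + 1 - i ≤ n + 1 := by omega
    have : tm q (Sn Fq q (n + 1)) i = ∑ j ∈ Finset.range (n + 1), tt Fq q i j := by
      rw [tm, Sn, frj_sum hq, Finset.mul_sum]; rfl
    rw [this, ← Finset.sum_range_add_sum_Ico _ hle, add_sub_cancel_left]
    apply V.sum
    intro j hj
    have := (Finset.mem_Ico.1 hj).1
    exact (V_tt hq2 i j).mono (by omega)
  have h4 : ∑ i ∈ Finset.range (n + 1), ∑ j ∈ Finset.range (n + 1 - i), tt Fq q i j = 1 := by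
    rw [← Finset.sum_range_diag_flip]
    simp_rw [← Finset.Nat.sum_antidiagonal_eq_sum_range_succ (fun i j => tt Fq q i j)]
    rw [Finset.sum_range_succ']
    simp only [tt_sum hq]
    simp [tt, cD, cL]
  rw [Finset.sum_sub_distrib, h4] at h3
  convert (h1.add h2).add h3 using 1
  ring

end Frob

/-! ### polynomials inside `K_∞` -/

theorem algC (c : Fq) : algebraMap Fq (LaurentSeries Fq) c = HahnSeries.C c := by
  rw [HahnSeries.algebraMap_apply']; simp

theorem io_monomial (n : ℕ) (c : Fq) :
    aeval (th Fq) (monomial n c) = HahnSeries.single (-n : ℤ) c := by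
  rw [aeval_monomial, algC, th_pow, HahnSeries.C_mul_eq_smul]
  ext i
  by_cases h : i = -n
  · subst h; simp
  · simp [HahnSeries.coeff_single_of_ne h]

theorem io_coeff (a : Fq[X]) (n : ℕ) : (aeval (th Fq) a).coeff (-n : ℤ) = a.coeff n := by
  induction a using Polynomial.induction_on' with
  | add p r hp hr => rw [map_add, HahnSeries.coeff_add, hp, hr, coeff_add]
  | monomial m c =>
    rw [io_monomial, coeff_monomial]
    by_cases h : m = n
    · subst h; simp
    · rw [if_neg h, HahnSeries.coeff_single_of_ne (by omega)]

theorem io_V (a : Fq[X]) : V (-a.natDegree) (aeval (th Fq) a) := by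
  rw [aeval_def, eval₂_eq_sum_range]
  apply V.sum
  intro i hi
  rw [algC, HahnSeries.C_mul_eq_smul]
  refine ((V_th_pow i).smul _).mono ?_
  have := Finset.mem_range.1 hi
  omega

theorem io_V1 {a : Fq[X]} (h : V 1 (aeval (th Fq) a)) : a = 0 := by
  ext n
  rw [← io_coeff, h _ (by omega), coeff_zero]

theorem io_mul_V1 {a : Fq[X]} {lam : LaurentSeries Fq} (hl : V 1 (lam - 1))
    (h : V 1 (aeval (th Fq) a * lam)) : a = 0 := by
  have h1 := (io_V a).mul hl
  have h2 : aeval (th Fq) a = aeval (th Fq) a * lam - aeval (th Fq) a * (lam - 1) := by ring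
  have h3 := congrArg (fun x : LaurentSeries Fq => x.coeff (-a.natDegree : ℤ)) h2
  simp only [HahnSeries.coeff_sub, io_coeff] at h3
  rw [h _ (by omega), h1 _ (by omega), sub_zero] at h3
  exact leadingCoeff_eq_zero.1 h3

theorem decomp {lam : LaurentSeries Fq} (hl : V 1 (lam - 1)) (n : ℕ) :
    ∀ x : LaurentSeries Fq, V (-n + 1) x →
      ∃ (a : Fq[X]) (m : LaurentSeries Fq), V 1 m ∧ x = aeval (th Fq) a * lam + m := by
  induction n with
  | zero => exact fun x hx => ⟨0, x, by simpa using hx, by simp⟩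
  | succ n ih =>
    intro x hx
    set w : LaurentSeries Fq := aeval (th Fq) (monomial n (x.coeff (-n : ℤ))) with hw
    have hwV : V (-n) w := by
      rw [hw, io_monomial]
      exact fun i hi => HahnSeries.coeff_single_of_ne hi.ne
    have h1 : V (-n + 1) (x - w) := by
      intro i hi
      rw [HahnSeries.coeff_sub]
      rcases (show i < -n ∨ i = -n by omega) with h | h
      · rw [hx i (by push_cast; omega), hwV i h, sub_zero]
      · subst h
        rw [hw, io_coeff, coeff_monomial, if_pos rfl, sub_self]
    obtain ⟨a, m, hm, hx'⟩ := ih (x - w * lam) (by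
      have := h1.sub (hwV.mul hl)
      convert this using 1
      ring)
    refine ⟨a + monomial n (x.coeff (-n : ℤ)), m, hm, ?_⟩
    rw [map_add, ← hw, add_mul, add_right_comm, ← hx', sub_add_cancel]

/-- exact order `-e` -/
def P (e : ℤ) (t : LaurentSeries Fq) : Prop := V (-e) t ∧ t.coeff (-e) ≠ 0

theorem P_of_ne {t : LaurentSeries Fq} (h : t ≠ 0) : P (-t.order) t := by
  refine ⟨by simpa using V_order t, ?_⟩
  rw [neg_neg]
  exact fun h' => h (HahnSeries.coeff_order_eq_zero.1 h')

theorem P.ne {e : ℤ} {t : LaurentSeries Fq} (h : P e t) : t ≠ 0 := by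
  rintro rfl; exact h.2 (by simp)

theorem P.order {e : ℤ} {t : LaurentSeries Fq} (h : P e t) : t.order = -e := by
  refine le_antisymm (HahnSeries.order_le_of_coeff_ne_zero h.2) ?_
  rw [HahnSeries.le_order_iff_forall h.ne]
  exact fun i hi => h.1 i hi

theorem P.pow {e : ℤ} {t : LaurentSeries Fq} (h : P e t) (k : ℕ) : P (k * e) (t ^ k) := by
  have := P_of_ne (pow_ne_zero k h.ne)
  rw [HahnSeries.order_pow, h.order] at this
  simpa using this

theorem P.add {e : ℤ} {t s : LaurentSeries Fq} (h : P e t) (hs : V (-e + 1) s) : P e (t + s) := by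
  refine ⟨h.1.add (hs.mono (by omega)), ?_⟩
  rw [HahnSeries.coeff_add, hs _ (by omega), add_zero]
  exact h.2

theorem P.smul {e : ℤ} {t : LaurentSeries Fq} (h : P e t) {c : Fq} (hc : c ≠ 0) : P e (c • t) := by
  refine ⟨h.1.smul c, ?_⟩
  rw [HahnSeries.coeff_smul, smul_eq_mul]
  exact mul_ne_zero hc h.2

section Act

variable {q : ℕ} {Ct : Module.End Fq (LaurentSeries Fq)}

theorem aeval_step (b : Fq[X]) (c : Fq) (t : LaurentSeries Fq) :
    aeval Ct (b * X + C c) t = aeval Ct b (Ct t) + c • t := by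
  simp

theorem P.step (hq : 2 ≤ q) (hCt : ∀ x, Ct x = x ^ q + th Fq * x) {e : ℤ} {t : LaurentSeries Fq}
    (he : 2 ≤ e) (h : P e t) : P (q * e) (Ct t) := by
  rw [hCt]
  have : (2 : ℤ) ≤ q := by exact_mod_cast hq
  refine (h.pow q).add ((V_th.mul h.1).mono ?_)
  nlinarith

theorem P.act (hq : 2 ≤ q) (hCt : ∀ x, Ct x = x ^ q + th Fq * x) (n : ℕ) :
    ∀ a : Fq[X], a.natDegree ≤ n → a ≠ 0 → ∀ (e : ℤ) (t : LaurentSeries Fq), 2 ≤ e → P e t →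
      ∃ e' ≥ e, P e' (aeval Ct a t) := by
  induction n with
  | zero =>
    intro a ha ha0 e t he ht
    rw [eq_C_of_natDegree_le_zero ha] at ha0 ⊢
    refine ⟨e, le_rfl, ?_⟩
    have := ht.smul (c := a.coeff 0) (by rintro h; rw [h] at ha0; simp at ha0)
    simpa using this
  | succ n ih =>
    intro a ha ha0 e t he ht
    by_cases hd : a.divX = 0
    · rw [divX_eq_zero_iff] at hd
      rw [hd] at ha0 ⊢
      refine ⟨e, le_rfl, ?_⟩
      have := ht.smul (c := a.coeff 0) (by rintro h; rw [h] at ha0; simp at ha0)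
      simpa using this
    · have hq' : (2 : ℤ) ≤ q := by exact_mod_cast hq
      have hlt : e + 1 < q * e := by nlinarith
      obtain ⟨e', he', hP⟩ := ih a.divX (by rw [natDegree_divX_eq_natDegree_tsub_one]; omega) hd
        (q * e) (Ct t) (by omega) (ht.step hq hCt he)
      refine ⟨e', by omega, ?_⟩
      rw [← divX_mul_X_add a, aeval_step]
      exact hP.add ((ht.1.smul _).mono (by omega))

theorem tors (hq : 2 ≤ q) (hCt : ∀ x, Ct x = x ^ q + th Fq * x) {a : Fq[X]} (ha : a ≠ 0)
    {t : LaurentSeries Fq} (h : aeval Ct a t = 0) : V (-1) t := by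
  by_cases ht : t = 0
  · rw [ht]; exact V.zero _
  by_cases h2 : 2 ≤ -t.order
  · obtain ⟨e', -, hP⟩ := P.act hq hCt _ a le_rfl ha _ t h2 (P_of_ne ht)
    exact absurd h hP.ne
  · exact (V_order t).mono (by omega)

theorem small (hCt : ∀ x, Ct x = x ^ q + th Fq * x) {t : LaurentSeries Fq} (ht : V (-1) t) :
    ∃ c : Fq[X], V 1 (t - aeval Ct c 1) := by
  refine ⟨C (t.coeff (-1)) * (X - 1) + C (t.coeff 0), ?_⟩
  have : aeval Ct (C (t.coeff (-1)) * (X - 1) + C (t.coeff 0)) (1 : LaurentSeries Fq) =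
      t.coeff (-1) • th Fq + t.coeff 0 • 1 := by
    simp [hCt]
  rw [this]
  intro i hi
  rcases (show i < -1 ∨ i = -1 ∨ i = 0 by omega) with h | rfl | rfl
  · simp only [HahnSeries.coeff_sub, HahnSeries.coeff_add, HahnSeries.coeff_smul, ht i h, V_th i h,
      V.one i (show i < 0 by omega), smul_zero, add_zero, sub_zero]
  · simp [th]
  · simp [th]

theorem act_poly (hCt : ∀ x, Ct x = x ^ q + th Fq * x) (a : Fq[X]) :
    ∀ b : Fq[X], ∃ b' : Fq[X], aeval Ct a (aeval (th Fq) b) = aeval (th Fq) b' := by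
  induction a using Polynomial.induction_on with
  | C c =>
    intro b
    refine ⟨C c * b, ?_⟩
    rw [map_mul, aeval_C, aeval_C, algC, HahnSeries.C_mul_eq_smul]
    simp
  | add p r hp hr =>
    intro b
    obtain ⟨x, hx⟩ := hp b
    obtain ⟨y, hy⟩ := hr b
    exact ⟨x + y, by rw [map_add, map_add, LinearMap.add_apply, hx, hy]⟩
  | monomial n c ih =>
    intro b
    obtain ⟨x, hx⟩ := ih (b ^ q + X * b)
    refine ⟨x, ?_⟩
    rw [← hx, pow_succ, ← mul_assoc, map_mul _ _ (X : Fq[X]), Module.End.mul_apply, aeval_X, hCt]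
    simp

end Act

theorem act_exp [Fintype Fq] {q : ℕ} {Ct : Module.End Fq (LaurentSeries Fq)}
    (hq : q = Fintype.card Fq) (hCt : ∀ x, Ct x = x ^ q + th Fq * x)
    {e : LaurentSeries Fq → LaurentSeries Fq} (he : IsE q e) (a : Fq[X]) :
    ∀ x : LaurentSeries Fq, aeval Ct a (e x) = e (aeval (th Fq) a * x) := by
  induction a using Polynomial.induction_on with
  | C c =>
    intro x
    rw [aeval_C (th Fq), algC, HahnSeries.C_mul_eq_smul, he.smul hq]
    simp
  | add p r hp hr =>
    intro x
    rw [map_add, map_add, LinearMap.add_apply, hp, hr, add_mul, he.add hq]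
  | monomial n c ih =>
    intro x
    rw [pow_succ, ← mul_assoc, map_mul _ _ (X : Fq[X]), Module.End.mul_apply, aeval_X, hCt,
      ← he.theta hq, ih, map_mul _ _ (X : Fq[X]), aeval_X, mul_assoc]

theorem isLog {q : ℕ} (hq : 2 ≤ q) {lg : LaurentSeries Fq → LaurentSeries Fq}
    (h : ∀ (x : LaurentSeries Fq) (F : HahnSeries.SummableFamily ℤ Fq ℕ),
      (∀ j : ℕ, cL Fq q j * F j = x ^ q ^ j) → lg x = F.hsum) (n : ℕ) :
    V n (lg 1 - Sn Fq q n) := by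
  have ht : ∀ N : ℕ, ∃ J : ℕ, ∀ j ≥ J, V N ((cL Fq q j)⁻¹) :=
    fun N => ⟨N, fun j hj => (V_cL hq j).mono (by omega)⟩
  have h1 := h 1 (mkFam _ ht) (fun j => by
    rw [mkFam_apply, mul_inv_cancel₀ (cL_ne hq j), one_pow])
  rw [h1]
  exact V_hsum (mkFam _ ht) n n fun j hj => (V_cL hq j).mono (by omega)

end Carl

/-- Let `C` be the Carlitz module over `A = F_q[θ]`
(`C_θ = τ + θ`), with exponential `exp_C = Σ_j τ^j/D_j` and logarithm
`log_C = Σ_j τ^j/ℓ_j` (characterized below on their domains of convergence via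
summable families).  Then `K_∞ = log_C(1)·A ⊕ M_∞`, where
`M_∞ = {x ∈ K_∞ : v_∞(x) ≥ 1}`, and consequently
`A ∩ exp_C(K_∞) = 𝓜 := {C_a(1) : a ∈ A}`; in particular `𝓜` equals its
radical `√𝓜 = {b ∈ A : ∃ a ∈ A∖{0}, C_a(b) ∈ 𝓜}`.

Here `K_∞ = F_q((1/θ))` is realized as `LaurentSeries Fq` in the variable
`u = 1/θ` (so `θ = u⁻¹` and `v_∞(x) ≥ 1` means the coefficients of `x` in
degrees `< 1` vanish), and `A` embeds via `a ↦ a(u⁻¹)`. -/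
theorem carlitz_exp_image_and_radical
    (Fq : Type*) [Field Fq] [Fintype Fq]
    (q : ℕ) (hq : q = Fintype.card Fq)
    -- θ ∈ K_∞ and the embedding of A:
    (θK : LaurentSeries Fq) (hθK : θK = HahnSeries.single (-1 : ℤ) 1)
    (AtoK : Polynomial Fq → LaurentSeries Fq)
    (hAtoK : ∀ a, AtoK a = Polynomial.aeval θK a)
    -- the Carlitz action `C_a = a(C_θ)`, `C_θ(x) = x^q + θx`:
    (Cθ : Module.End Fq (LaurentSeries Fq))
    (hCθ : ∀ x, Cθ x = x ^ q + θK * x)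
    (CC : Polynomial Fq → LaurentSeries Fq → LaurentSeries Fq)
    (hCC : ∀ a x, CC a x = Polynomial.aeval Cθ a x)
    -- the coefficient sequences `D_j` and `ℓ_j`:
    (D : ℕ → Polynomial Fq) (hD0 : D 0 = 1)
    (hD : ∀ i, D (i + 1) = (Polynomial.X ^ q ^ (i + 1) - Polynomial.X) * (D i) ^ q)
    (L : ℕ → Polynomial Fq) (hL0 : L 0 = 1)
    (hL : ∀ i, L (i + 1) = (Polynomial.X - Polynomial.X ^ q ^ (i + 1)) * L i)
    -- the Carlitz exponential and logarithm, characterized as sums of the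
    -- summable families with terms `x^{q^j}/D_j` resp. `x^{q^j}/ℓ_j`:
    (expC logC : LaurentSeries Fq → LaurentSeries Fq)
    (hexp : ∀ (x : LaurentSeries Fq) (F : HahnSeries.SummableFamily ℤ Fq ℕ),
      (∀ j : ℕ, AtoK (D j) * F j = x ^ q ^ j) → expC x = F.hsum)
    (hlog : ∀ (x : LaurentSeries Fq) (F : HahnSeries.SummableFamily ℤ Fq ℕ),
      (∀ j : ℕ, AtoK (L j) * F j = x ^ q ^ j) → logC x = F.hsum) :
    -- (a)  K_∞ = log_C(1)·A ⊕ M_∞ :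
    (∀ x : LaurentSeries Fq,
      ∃! pr : Polynomial Fq × LaurentSeries Fq,
        (∀ i : ℤ, i < 1 → pr.2.coeff i = 0) ∧
        x = AtoK pr.1 * logC 1 + pr.2) ∧
    -- (b)  A ∩ exp_C(K_∞) = 𝓜 :
    ({y : LaurentSeries Fq | (∃ a : Polynomial Fq, AtoK a = y) ∧
        ∃ x : LaurentSeries Fq, expC x = y} =
      {y : LaurentSeries Fq | ∃ a : Polynomial Fq, CC a 1 = y}) ∧
    -- (c)  √𝓜 = 𝓜 :
    ({b : Polynomial Fq | ∃ a : Polynomial Fq, a ≠ 0 ∧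
        ∃ c : Polynomial Fq, CC a (AtoK b) = CC c 1} =
      {b : Polynomial Fq | ∃ c : Polynomial Fq, AtoK b = CC c 1}) := by
  have hq2 : 2 ≤ q := Carl.q_ge hq
  have hth : θK = Carl.th Fq := hθK
  obtain rfl : AtoK = fun a => Polynomial.aeval θK a := funext hAtoK
  obtain rfl : CC = fun a x => Polynomial.aeval Cθ a x := by
    funext a x; exact hCC a x
  subst hth
  clear hθK hAtoK hCC
  have hDj : ∀ j, Polynomial.aeval (Carl.th Fq) (D j) = Carl.cD Fq q j := by
    intro j
    induction j with
    | zero => rw [hD0, Carl.cD, map_one]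
    | succ j ih => rw [hD, Carl.cD, map_mul, map_pow, ih]; simp
  have hLj : ∀ j, Polynomial.aeval (Carl.th Fq) (L j) = Carl.cL Fq q j := by
    intro j
    induction j with
    | zero => rw [hL0, Carl.cL, map_one]
    | succ j ih => rw [hL, Carl.cL, map_mul, ih]; simp
  simp only [hDj] at hexp
  simp only [hLj] at hlog
  have he : Carl.IsE q expC := Carl.isE_of hq2 hexp
  have hl := Carl.isLog hq2 hlog
  have hl1 : Carl.V 1 (logC 1 - 1) := by
    have := hl 1
    simpa [Carl.Sn, Carl.cL] using this
  have hel : expC (logC 1) = 1 := Carl.exp_log_one hq he hl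
  have hca : ∀ a : Fq[X], expC (Polynomial.aeval (Carl.th Fq) a * logC 1) =
      Polynomial.aeval Cθ a 1 := by
    intro a
    rw [← Carl.act_exp hq hCθ he, hel]
  have hdec : ∀ x : LaurentSeries Fq, ∃ (a : Fq[X]) (m : LaurentSeries Fq), Carl.V 1 m ∧
      x = Polynomial.aeval (Carl.th Fq) a * logC 1 + m := by
    intro x
    obtain ⟨n, hn⟩ := Carl.exists_V x
    exact Carl.decomp hl1 (n + 1) x (hn.mono (by push_cast; omega))
  have hM : ∀ c : Fq[X], ∃ b : Fq[X], Polynomial.aeval Cθ c 1 = Polynomial.aeval (Carl.th Fq) b := by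
    intro c
    simpa using Carl.act_poly hCθ c 1
  have hexpdec : ∀ x : LaurentSeries Fq, ∃ c : Fq[X],
      Carl.V 1 (expC x - Polynomial.aeval Cθ c 1) := by
    intro x
    obtain ⟨a, m, hm, rfl⟩ := hdec x
    refine ⟨a, ?_⟩
    rw [he.add hq, hca, add_sub_cancel_left]
    exact he.V hq2 (n := 1) hm
  have hfin : ∀ b c : Fq[X],
      Carl.V 1 (Polynomial.aeval (Carl.th Fq) b - Polynomial.aeval Cθ c 1) →
      Polynomial.aeval (Carl.th Fq) b = Polynomial.aeval Cθ c 1 := by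
    intro b c h
    obtain ⟨b', hb'⟩ := hM c
    rw [hb'] at h ⊢
    rw [← map_sub] at h
    rw [sub_eq_zero.1 (Carl.io_V1 h)]
  refine ⟨?_, ?_, ?_⟩
  · intro x
    obtain ⟨a, m, hm, hx⟩ := hdec x
    refine ⟨(a, m), ⟨hm, hx⟩, ?_⟩
    rintro ⟨a', m'⟩ ⟨hm', hx'⟩
    change Carl.V 1 m' at hm'
    simp only at hx'
    have h1 : Polynomial.aeval (Carl.th Fq) (a' - a) * logC 1 = m - m' := by
      rw [map_sub, sub_mul, sub_eq_sub_iff_add_eq_add, ← hx', hx, add_comm]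
    have h2 : a' - a = 0 := Carl.io_mul_V1 hl1 (h1 ▸ hm.sub hm')
    have h3 : a' = a := sub_eq_zero.1 h2
    rw [h2] at h1
    simp only [map_zero, zero_mul] at h1
    rw [h3, sub_eq_zero.1 h1.symm]
  · ext y
    constructor
    · rintro ⟨⟨b, rfl⟩, x, hx⟩
      obtain ⟨c, hc⟩ := hexpdec x
      rw [hx] at hc
      exact ⟨c, (hfin b c hc).symm⟩
    · rintro ⟨c, rfl⟩
      obtain ⟨b, hb⟩ := hM c
      exact ⟨⟨b, hb.symm⟩, _, hca c⟩
  · ext b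
    constructor
    · rintro ⟨a, ha, c, hc⟩
      simp only at hc
      have ha' : Polynomial.aeval (Carl.th Fq) a ≠ 0 := by
        intro h
        exact ha (Carl.io_V1 (h ▸ Carl.V.zero 1))
      set x := (Polynomial.aeval (Carl.th Fq) a)⁻¹ *
        (Polynomial.aeval (Carl.th Fq) c * logC 1) with hx
      have h1 : Polynomial.aeval Cθ a (expC x) = Polynomial.aeval Cθ c 1 := by
        rw [Carl.act_exp hq hCθ he, hx, mul_inv_cancel_left₀ ha', hca]
      have h2 : Polynomial.aeval Cθ a (Polynomial.aeval (Carl.th Fq) b - expC x) = 0 := by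
        rw [map_sub, h1, hc, sub_self]
      obtain ⟨c1, hc1⟩ := Carl.small hCθ (Carl.tors hq2 hCθ ha h2)
      obtain ⟨c2, hc2⟩ := hexpdec x
      refine ⟨c1 + c2, hfin b _ ?_⟩
      convert hc1.add hc2 using 1
      rw [map_add, LinearMap.add_apply]
      ring
    · rintro ⟨c, hc⟩
      refine ⟨1, one_ne_zero, c, ?_⟩
      simpa using hc
end
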